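/- Let K be an algebraically closed field of characteristic 0. Let A_1, A_2, A_3, A_4 be pairwise commuting nilpotent 10×10 matrices over K admitting a cyclic vector v ∈ K^10 (the vectors p(A_1,…,A_4)·v, p ∈ K[α_1,…,α_4], span K^10), and for each k ≥ 1 let V_k ⊆ K^10 be the subspace spanned by all vectors A_{i_1}·A_{i_2}⋯A_{i_m}·v with m ≥ k and i_1,…,i_m ∈ {1,2,3,4}. Assume dim V_1 = 9, dim V_2 = 5, dim V_3 = 3, dim V_4 = 1 and V_5 = 0 (i.e., the corresponding local algebra has Hilbert function (1,4,2,2,1)). Then (A_1,…,A_4) lies in the Zariski closure of the set of simultaneously diagonalizable quadruples of 10×10 matrices: every polynomial over K in the 4·100 matrix entries that vanishes at every simultaneously diagonalizable quadruple of 10×10 matrices also vanishes at (A_1,…,A_4). (This is the matrix form of: every local algebra with Hilbert function (1,4,2,2,1) is smoothable.) -/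

import Mathlib

open Matrix

/-- A tuple of square matrices is simultaneously diagonalizable. -/
def SimDiag {K : Type*} [Field K] {N ι : Type*} [Fintype ι] [DecidableEq ι]
    (A : N → Matrix ι ι K) : Prop :=
  ∃ P : Matrix ι ι K, IsUnit P ∧ ∀ i, (P⁻¹ * A i * P).IsDiag

/-- A tuple of square matrices lies in the Zariski closure of the set of simultaneously
diagonalizable tuples (the principal component): every polynomial in the matrix entries
vanishing on all simultaneously diagonalizable tuples vanishes at the given tuple. -/
def InSimDiagClosure {K : Type*} [Field K] {N ι : Type*} [Fintype ι] [DecidableEq ι]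
    (A : N → Matrix ι ι K) : Prop :=
  ∀ Φ : MvPolynomial (N × ι × ι) K,
    (∀ B : N → Matrix ι ι K, SimDiag B →
      MvPolynomial.eval (fun x => B x.1 x.2.1 x.2.2) Φ = 0) →
    MvPolynomial.eval (fun x => A x.1 x.2.1 x.2.2) Φ = 0

/-- The span of all vectors `A_{i₁}⋯A_{iₘ}·v` with `m ≥ k` (the image of `𝔫ᵏ` in the
corresponding module). -/
def wordSpan {K : Type*} [Field K] (A : Fin 4 → Matrix (Fin 10) (Fin 10) K)
    (v : Fin 10 → K) (k : ℕ) : Submodule K (Fin 10 → K) :=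
  Submodule.span K
    {w : Fin 10 → K | ∃ l : List (Fin 4), k ≤ l.length ∧ w = (l.map A).prod.mulVec v}

namespace CommutingTuple

section Closure

variable {K : Type*} [Field K] {N N' ι κ : Type*} [Fintype ι] [DecidableEq ι]
  [Fintype κ] [DecidableEq κ]

theorem simDiag_iff_mulVec (A : N → Matrix ι ι K) :
    SimDiag A ↔ ∃ P : Matrix ι ι K, IsUnit P ∧ ∃ d : N → ι → K, ∀ i, A i * P = P * diagonal (d i) := by
  constructor
  · rintro ⟨P, hP, h⟩
    refine ⟨P, hP, fun i => (P⁻¹ * A i * P).diag, fun i => ?_⟩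
    rw [(h i).diagonal_diag, mul_assoc, ← mul_assoc P,
      Matrix.mul_nonsing_inv _ ((Matrix.isUnit_iff_isUnit_det _).1 hP), one_mul]
  · rintro ⟨P, hP, d, h⟩
    refine ⟨P, hP, fun i => ?_⟩
    rw [mul_assoc, h i, ← mul_assoc, Matrix.nonsing_inv_mul _ ((Matrix.isUnit_iff_isUnit_det _).1 hP),
      one_mul]
    exact Matrix.isDiag_diagonal _

theorem eval_bind₁_eq {σ τ R : Type*} [CommSemiring R] (g : σ → R) (F : τ → MvPolynomial σ R)
    (Φ : MvPolynomial τ R) : MvPolynomial.eval g (MvPolynomial.bind₁ F Φ) =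
      MvPolynomial.eval (fun x => MvPolynomial.eval g (F x)) Φ := by
  induction Φ using MvPolynomial.induction_on with
  | C a => simp
  | add p q hp hq => rw [map_add, map_add, hp, hq, map_add]
  | mul_X p i hp => rw [map_mul, map_mul, hp, map_mul, MvPolynomial.bind₁_X_right,
      MvPolynomial.eval_X]

/-- The closure of the simultaneously diagonalizable tuples is respected by polynomial maps that
preserve simultaneous diagonalizability. -/
theorem InSimDiagClosure.subst (F : N' × κ × κ → MvPolynomial (N × ι × ι) K)
    (hF : ∀ B : N → Matrix ι ι K, SimDiag B → SimDiag (fun i => Matrix.of fun a b =>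
      MvPolynomial.eval (fun x : N × ι × ι => B x.1 x.2.1 x.2.2) (F (i, a, b))))
    {A : N → Matrix ι ι K} (hA : InSimDiagClosure A) :
    InSimDiagClosure (fun i => Matrix.of fun a b =>
      MvPolynomial.eval (fun x : N × ι × ι => A x.1 x.2.1 x.2.2) (F (i, a, b))) := by
  intro Φ hΦ
  simp only [Matrix.of_apply, Prod.mk.eta, ← eval_bind₁_eq]
  refine hA _ fun B hB => ?_
  have := hΦ _ (hF B hB)
  simpa only [Matrix.of_apply, Prod.mk.eta, ← eval_bind₁_eq] using this

theorem InSimDiagClosure.of_simDiag {A : N → Matrix ι ι K} (h : SimDiag A) :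
    InSimDiagClosure A := fun _ hΦ => hΦ A h

theorem SimDiag.conj {A : N → Matrix ι ι K} (h : SimDiag A) (S : Matrix κ ι K) (S' : Matrix ι κ K)
    (h1 : S * S' = 1) (h2 : S' * S = 1) : SimDiag fun i => S * A i * S' := by
  obtain ⟨P, hP, d, hd⟩ := (simDiag_iff_mulVec A).1 h
  obtain ⟨Q, hQ1, hQ2⟩ : ∃ Q, P * Q = 1 ∧ Q * P = 1 := by
    obtain ⟨u, rfl⟩ := hP
    exact ⟨_, u.mul_inv, u.inv_mul⟩
  let e : ι ≃ κ := by
    have h3 : Fintype.card ι = Fintype.card κ := by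
      have := Matrix.square_of_invertible S S' h1 h2
      exact this.symm
    exact Fintype.equivOfCardEq h3
  refine (simDiag_iff_mulVec _).2 ⟨S * P.submatrix id e.symm, ?_, fun i => d i ∘ e.symm, fun i => ?_⟩
  · refine IsUnit.of_mul_eq_one (Q.submatrix e.symm id * S') ?_
    rw [Matrix.mul_assoc, ← Matrix.mul_assoc _ _ S']
    have : P.submatrix id e.symm * Q.submatrix e.symm id = (P * Q).submatrix id id :=
      Matrix.submatrix_mul_equiv P Q id e.symm id
    rw [this, hQ1]
    simp [h1]
  · have h4 : (P * diagonal (d i)).submatrix id e.symm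
        = P.submatrix id e.symm * diagonal (d i ∘ e.symm) := by
      ext a b
      simp
    have h5 : (A i * P).submatrix id e.symm = A i * P.submatrix id e.symm := by
      ext a b
      simp [Matrix.mul_apply]
    calc S * A i * S' * (S * P.submatrix id e.symm)
        = S * A i * (S' * S) * P.submatrix id e.symm := by simp only [Matrix.mul_assoc]
      _ = S * (A i * P.submatrix id e.symm) := by rw [h2]; simp only [Matrix.mul_assoc, Matrix.mul_one]
      _ = _ := by rw [← h5, hd, h4]; simp only [Matrix.mul_assoc]

theorem InSimDiagClosure.conj {A : N → Matrix ι ι K} (h : InSimDiagClosure A)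
    (S : Matrix κ ι K) (S' : Matrix ι κ K)
    (h1 : S * S' = 1) (h2 : S' * S = 1) : InSimDiagClosure fun i => S * A i * S' := by
  let F : N × κ × κ → MvPolynomial (N × ι × ι) K := fun x =>
    ∑ j, (∑ k, MvPolynomial.C (S x.2.1 k) * MvPolynomial.X (x.1, k, j)) * MvPolynomial.C (S' j x.2.2)
  have key : ∀ B : N → Matrix ι ι K, (fun i => Matrix.of fun a b =>
      MvPolynomial.eval (fun x : N × ι × ι => B x.1 x.2.1 x.2.2) (F (i, a, b))) =
      fun i => S * B i * S' := by
    intro B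
    ext i a b
    simp [F, Matrix.mul_apply]
  have := InSimDiagClosure.subst F (fun B hB => by rw [key]; exact SimDiag.conj hB S S' h1 h2) h
  rwa [key] at this

theorem InSimDiagClosure.of_mem_adjoin {A : N → Matrix ι ι K} (h : InSimDiagClosure A)
    {A' : N' → Matrix ι ι K} (hA' : ∀ i, A' i ∈ Algebra.adjoin K (Set.range A)) :
    InSimDiagClosure A' := by
  have h1 : ∀ i, ∃ f : FreeAlgebra K N, FreeAlgebra.lift K A f = A' i := by
    intro i
    have := hA' i
    rw [Algebra.adjoin_range_eq_range_freeAlgebra_lift] at this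
    exact this
  choose f hf using h1
  let G : N → Matrix ι ι (MvPolynomial (N × ι × ι) K) := fun i => Matrix.of fun a b =>
    MvPolynomial.X (i, a, b)
  let F : N' × ι × ι → MvPolynomial (N × ι × ι) K := fun x =>
    FreeAlgebra.lift K G (f x.1) x.2.1 x.2.2
  have key : ∀ B : N → Matrix ι ι K, (fun i => Matrix.of fun a b =>
      MvPolynomial.eval (fun x : N × ι × ι => B x.1 x.2.1 x.2.2) (F (i, a, b))) =
      fun i => FreeAlgebra.lift K B (f i) := by
    intro B
    have : ((MvPolynomial.aeval (R := K) (fun x : N × ι × ι => B x.1 x.2.1 x.2.2)).mapMatrix).comp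
        (FreeAlgebra.lift K G) = FreeAlgebra.lift K B := by
      apply FreeAlgebra.hom_ext
      ext i a b
      simp [G]
    funext i
    rw [← this]
    ext a b
    rfl
  have := InSimDiagClosure.subst F (fun B hB => by
    rw [key]
    obtain ⟨P, hP, d, hd⟩ := (simDiag_iff_mulVec B).1 hB
    have : ∀ g : FreeAlgebra K N, ∃ e : ι → K, FreeAlgebra.lift K B g * P = P * diagonal e := by
      intro g
      induction g using FreeAlgebra.induction with
      | grade0 r =>
        refine ⟨fun _ => r, ?_⟩
        rw [AlgHom.commutes, Algebra.commutes]
        rfl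
      | grade1 i => exact ⟨d i, by rw [FreeAlgebra.lift_ι_apply]; exact hd i⟩
      | mul a b ha hb =>
        obtain ⟨e, he⟩ := ha
        obtain ⟨e', he'⟩ := hb
        refine ⟨fun k => e k * e' k, ?_⟩
        rw [map_mul, mul_assoc, he', ← mul_assoc, he, mul_assoc, diagonal_mul_diagonal]
      | add a b ha hb =>
        obtain ⟨e, he⟩ := ha
        obtain ⟨e', he'⟩ := hb
        refine ⟨fun k => e k + e' k, ?_⟩
        rw [map_add, add_mul, he, he', ← mul_add, diagonal_add]
    choose e he using this
    exact (simDiag_iff_mulVec _).2 ⟨P, hP, fun i => e (f i), fun i => he _⟩) h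
  rw [key] at this
  simpa only [hf] using this

theorem InSimDiagClosure.of_infinite {A C : N → Matrix ι ι K}
    (h : {t : K | InSimDiagClosure fun i => A i + t • C i}.Infinite) : InSimDiagClosure A := by
  intro Φ hΦ
  let p : Polynomial K := MvPolynomial.aeval (fun x : N × ι × ι =>
    Polynomial.C (A x.1 x.2.1 x.2.2) + Polynomial.X * Polynomial.C (C x.1 x.2.1 x.2.2)) Φ
  have key : ∀ t, p.eval t =
      MvPolynomial.eval (fun x : N × ι × ι => (A x.1 + t • C x.1) x.2.1 x.2.2) Φ := by
    intro t
    have h1 : p.eval t = (Polynomial.aeval t) p := by simp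
    rw [h1]
    simp only [p]
    rw [← AlgHom.comp_apply, MvPolynomial.comp_aeval, MvPolynomial.aeval_def, MvPolynomial.eval]
    simp [MvPolynomial.coe_eval₂Hom, mul_comm t]
  have hp : p = 0 := by
    refine Polynomial.eq_zero_of_infinite_isRoot _ (h.mono fun t ht => ?_)
    rw [Set.mem_ofPred_eq, Polynomial.IsRoot.def, key]
    exact ht Φ hΦ
  have := key 0
  rw [hp] at this
  simpa using this.symm

end Closure

section EndClosure

variable {K V V' : Type*} [Field K] [AddCommGroup V] [Module K V] [AddCommGroup V'] [Module K V']
  [Module.Finite K V] [Module.Finite K V'] {N N' ι : Type*} [Fintype ι] [DecidableEq ι]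

/-- A tuple of endomorphisms whose matrices (in some, equivalently every, basis) lie in the closure
of the simultaneously diagonalizable tuples. -/
def EndClosure (T : N → Module.End K V) : Prop :=
  InSimDiagClosure fun i =>
    LinearMap.toMatrix (Module.finBasis K V) (Module.finBasis K V) (T i)

omit [Module.Finite K V] in
theorem inSimDiagClosure_toMatrix_of_basis {κ : Type*} [Fintype κ] [DecidableEq κ]
    (b : Module.Basis ι K V) (b' : Module.Basis κ K V) (T : N → Module.End K V)
    (h : InSimDiagClosure fun i => LinearMap.toMatrix b b (T i)) :
    InSimDiagClosure fun i => LinearMap.toMatrix b' b' (T i) := by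
  have := InSimDiagClosure.conj h (b'.toMatrix b) (b.toMatrix b') (by simp) (by simp)
  simpa only [basis_toMatrix_mul_linearMap_toMatrix_mul_basis_toMatrix] using this

theorem endClosure_iff (b : Module.Basis ι K V) (T : N → Module.End K V) :
    EndClosure T ↔ InSimDiagClosure fun i => LinearMap.toMatrix b b (T i) :=
  ⟨inSimDiagClosure_toMatrix_of_basis _ _ T, inSimDiagClosure_toMatrix_of_basis _ _ T⟩

theorem EndClosure.of_eigenbasis (b : Module.Basis ι K V) {T : N → Module.End K V}
    (h : ∀ i j, ∃ μ : K, T i (b j) = μ • b j) : EndClosure T := by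
  rw [endClosure_iff b]
  apply InSimDiagClosure.of_simDiag
  choose μ hμ using h
  refine ⟨1, isUnit_one, fun i => ?_⟩
  intro a c hac
  simp [LinearMap.toMatrix_apply, hμ, hac.symm]

theorem EndClosure.of_equiv (e : V' ≃ₗ[K] V) {T : N → Module.End K V} {T' : N → Module.End K V'}
    (h : ∀ i r, e (T' i r) = T i (e r)) (hT' : EndClosure T') : EndClosure T := by
  rw [endClosure_iff ((Module.finBasis K V').map e)]
  unfold EndClosure at hT'
  convert hT' using 2 with i
  ext a c
  simp [LinearMap.toMatrix_apply, ← h]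

theorem EndClosure.of_mem_adjoin {T : N → Module.End K V} (h : EndClosure T)
    {T' : N' → Module.End K V} (hT' : ∀ i, T' i ∈ Algebra.adjoin K (Set.range T)) :
    EndClosure T' := by
  unfold EndClosure at *
  refine InSimDiagClosure.of_mem_adjoin h fun i => ?_
  let φ : Module.End K V →ₐ[K] _ := (LinearMap.toMatrixAlgEquiv (Module.finBasis K V)).toAlgHom
  have : φ (T' i) ∈ (Algebra.adjoin K (Set.range T)).map φ := Subalgebra.mem_map.2 ⟨_, hT' i, rfl⟩
  rw [AlgHom.map_adjoin, ← Set.range_comp] at this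
  exact this

theorem EndClosure.of_infinite {T C : N → Module.End K V}
    (h : {t : K | EndClosure fun i => T i + t • C i}.Infinite) : EndClosure T := by
  unfold EndClosure at *
  simp only [map_add, map_smul] at h
  exact InSimDiagClosure.of_infinite h

theorem EndClosure.of_finite [Infinite K] {T C : N → Module.End K V} (s : Set K) (hs : s.Finite)
    (h : ∀ t, t ∉ s → EndClosure fun i => T i + t • C i) : EndClosure T :=
  EndClosure.of_infinite (hs.infinite_compl.mono fun t ht => h t ht)

end EndClosure

section Deformation

variable {K V : Type*} [Field K] [Infinite K] [AddCommGroup V] [Module K V] [Module.Finite K V]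
  {N ι : Type*} [Fintype ι]

/-- A tuple whose restriction to a diagonalized hyperplane is deformed by separating the points of
that hyperplane. -/
theorem EndClosure.of_diagonal_hyperplane (o : V) (w : ι → V)
    (hspan : ⊤ ≤ Submodule.span K (insert o (Set.range w)))
    (hcard : Fintype.card ι + 1 = Module.finrank K V) {T : N → Module.End K V}
    (hw : ∀ i j, ∃ μ : K, T i (w j) = μ • w j) (h1 : ∀ i, T i o ∈ Submodule.span K (Set.range w))
    (h2 : ∀ k i, T k (T i o) = 0) : EndClosure T := by
  classical
  have hr : ∀ o' (w' : ι → V), Set.range (fun x : Option ι => x.elim o' w') =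
      insert o' (Set.range w') := by
    intro o' w'
    ext x
    constructor
    · rintro ⟨_ | j, rfl⟩
      · exact Set.mem_insert _ _
      · exact Set.mem_insert_of_mem _ ⟨j, rfl⟩
    · rintro (rfl | ⟨j, rfl⟩)
      · exact ⟨none, rfl⟩
      · exact ⟨some j, rfl⟩
  let b : Module.Basis (Option ι) K V := basisOfTopLeSpanOfCardEqFinrank
    (fun x => x.elim o w) (by rw [hr]; exact hspan) (by rw [Fintype.card_option, hcard])
  have hb0 : b none = o := by simp [b]
  have hbs : ∀ j, b (some j) = w j := by simp [b]
  have hli : LinearIndependent K w := by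
    have := b.linearIndependent.comp some (Option.some_injective _)
    convert this using 1
    ext j
    simp [hbs]
  choose μ hμ using hw
  have h1' : ∀ i, ∃ c : ι → K, ∑ j, c j • w j = T i o := by
    intro i
    obtain ⟨c, hc⟩ := (Submodule.mem_span_range_iff_exists_fun K).1 (h1 i)
    exact ⟨c, hc⟩
  choose v hv using h1'
  have hvμ : ∀ k i j, v i j * μ k j = 0 := by
    intro k i
    have := h2 k i
    rw [← hv i, map_sum] at this
    simp only [map_smul, hμ, smul_smul] at this
    exact Fintype.linearIndependent_iff.1 hli _ this
  let C : N → Module.End K V := fun i => b.constr K fun x => x.elim 0 fun j => v i j • w j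
  have hC0 : ∀ i, C i o = 0 := fun i => by
    rw [← hb0]; simp only [C]; rw [b.constr_basis]; rfl
  have hCs : ∀ i j, C i (w j) = v i j • w j := fun i j => by
    rw [← hbs]; simp only [C]; rw [b.constr_basis]; simp [hbs]
  refine EndClosure.of_finite (C := C) {0} (Set.finite_singleton 0) fun t ht => ?_
  have ht : t ≠ 0 := ht
  let c : ι → K := fun j => if ∀ i, v i j = 0 then 0 else t⁻¹
  let o' := o - ∑ j, c j • w j
  have hsp : ⊤ ≤ Submodule.span K (insert o' (Set.range w)) := by
    refine hspan.trans (Submodule.span_le.2 (Set.insert_subset ?_ ?_))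
    · have : o = o' + ∑ j, c j • w j := by simp [o']
      rw [this]
      refine add_mem (Submodule.subset_span (Set.mem_insert _ _)) (Submodule.sum_mem _ fun j _ =>
        Submodule.smul_mem _ _ (Submodule.subset_span (Set.mem_insert_of_mem _ ⟨j, rfl⟩)))
    · exact fun x hx => Submodule.subset_span (Set.mem_insert_of_mem _ hx)
  let b' : Module.Basis (Option ι) K V := basisOfTopLeSpanOfCardEqFinrank
    (fun x => x.elim o' w) (by rw [hr]; exact hsp) (by rw [Fintype.card_option, hcard])
  refine EndClosure.of_eigenbasis b' fun i x => ?_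
  cases x with
  | none =>
    refine ⟨0, ?_⟩
    have : b' none = o' := by simp [b']
    rw [this]
    simp only [o', LinearMap.add_apply, LinearMap.smul_apply, map_sub, map_sum, map_smul, hC0, hCs,
      hμ, ← hv, zero_smul, smul_zero, smul_smul]
    rw [add_zero, ← Finset.sum_sub_distrib]
    refine Finset.sum_eq_zero fun j _ => ?_
    rw [← add_smul, smul_smul, ← sub_smul]
    convert zero_smul K (w j)
    simp only [c]
    split_ifs with h
    · simp [h]
    · push Not at h
      obtain ⟨k, hk⟩ := h
      have := (mul_eq_zero.1 (hvμ i k j)).resolve_left hk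
      rw [this]
      field_simp
      ring
  | some j =>
    refine ⟨μ i j + t * v i j, ?_⟩
    have : b' (some j) = w j := by simp [b']
    rw [this]
    simp [hμ, hCs, add_smul, smul_smul]

theorem EndClosure.of_diagonal_squares [Fintype N] [DecidableEq N] (o : V) (e : N → V) (w : ι → V)
    (hspan : ⊤ ≤ Submodule.span K (insert o (Set.range e ∪ Set.range w)))
    (hcard : Fintype.card N + Fintype.card ι + 1 = Module.finrank K V) {T : N → Module.End K V}
    (hw : ∀ i j, ∃ μ : K, T i (w j) = μ • w j) (h1 : ∀ i, T i o = e i) (σ : N → V)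
    (h2 : ∀ i j, T i (e j) = if i = j then σ i else 0)
    (hσ : ∀ i, σ i ∈ Submodule.span K (Set.range w)) (h3 : ∀ i j, T i (σ j) = 0) :
    EndClosure T := by
  let b : Module.Basis (Option (N ⊕ ι)) K V := basisOfTopLeSpanOfCardEqFinrank
    (fun x => x.elim o (Sum.elim e w)) (by
      refine hspan.trans (Submodule.span_mono ?_)
      rintro x (rfl | ⟨j, rfl⟩ | ⟨j, rfl⟩)
      · exact ⟨none, rfl⟩
      · exact ⟨some (.inl j), rfl⟩
      · exact ⟨some (.inr j), rfl⟩) (by rw [Fintype.card_option, Fintype.card_sum, hcard])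
  have hb0 : b none = o := by simp [b]
  have hbe : ∀ j, b (some (.inl j)) = e j := by simp [b]
  have hbw : ∀ j, b (some (.inr j)) = w j := by simp [b]
  let C : N → Module.End K V := fun i => b.constr K fun x => x.elim 0
    (Sum.elim (fun j => if i = j then e j else 0) 0)
  have hC0 : ∀ i, C i o = 0 := fun i => by
    rw [← hb0]; simp only [C]; rw [b.constr_basis]; rfl
  have hCe : ∀ i j, C i (e j) = if i = j then e j else 0 := fun i j => by
    rw [← hbe]; simp only [C]; rw [b.constr_basis]; simp [hbe]
  have hCw : ∀ i j, C i (w j) = 0 := fun i j => by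
    rw [← hbw]; simp only [C]; rw [b.constr_basis]; simp
  have hCσ : ∀ i j, C i (σ j) = 0 := fun i j => by
    have : Submodule.span K (Set.range w) ≤ LinearMap.ker (C i) := by
      rw [Submodule.span_le]
      rintro _ ⟨k, rfl⟩
      exact hCw i k
    exact this (hσ j)
  refine EndClosure.of_finite (C := C) {0} (Set.finite_singleton 0) fun t ht => ?_
  have ht : t ≠ 0 := ht
  let p : N → V := fun j => e j + t⁻¹ • σ j
  have hp : ∀ i j, (T i + t • C i) (p j) = if i = j then t • p j else 0 := by
    intro i j
    simp only [p, LinearMap.add_apply, LinearMap.smul_apply, map_add, map_smul, h2, h3, hCe, hCσ]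
    split_ifs with h
    · subst h
      simp [smul_smul, ht, add_comm]
    · simp
  let o' := o - ∑ j, t⁻¹ • p j
  have ho : ∀ i, (T i + t • C i) o' = - (t⁻¹ • σ i) := by
    intro i
    simp only [o', map_sub, map_sum, map_smul, hp]
    simp [h1, hC0, smul_smul, ht, p]
  have hmem : ∀ j, w j ∈ Submodule.span K (Set.range (Sum.elim p w)) := fun j =>
    Submodule.subset_span ⟨.inr j, rfl⟩
  have hσ' : ∀ j, σ j ∈ Submodule.span K (Set.range (Sum.elim p w)) := fun j =>
    Submodule.span_le.2 (by rintro _ ⟨k, rfl⟩; exact hmem k) (hσ j)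
  refine EndClosure.of_diagonal_hyperplane o' (Sum.elim p w) ?_ (by rw [Fintype.card_sum, hcard])
    ?_ ?_ ?_
  · have hle : Submodule.span K (Set.range (Sum.elim p w)) ≤
        Submodule.span K (insert o' (Set.range (Sum.elim p w))) :=
      Submodule.span_mono (Set.subset_insert _ _)
    refine hspan.trans (Submodule.span_le.2 ?_)
    rintro x (rfl | ⟨j, rfl⟩ | ⟨j, rfl⟩)
    · have : x = o' + ∑ j, t⁻¹ • p j := by simp [o']
      rw [this]
      exact add_mem (Submodule.subset_span (Set.mem_insert _ _)) (hle (Submodule.sum_mem _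
        fun j _ => Submodule.smul_mem _ _ (Submodule.subset_span ⟨.inl j, rfl⟩)))
    · have : e j = p j - t⁻¹ • σ j := by simp [p]
      rw [this]
      exact hle (sub_mem (Submodule.subset_span ⟨.inl j, rfl⟩) (Submodule.smul_mem _ _ (hσ' j)))
    · exact hle (hmem j)
  · rintro i (j | j)
    · refine ⟨if i = j then t else 0, ?_⟩
      simp only [Sum.elim_inl, hp]
      split_ifs <;> simp
    · obtain ⟨μ, hμ⟩ := hw i j
      exact ⟨μ, by simp [hμ, hCw]⟩
  · intro i
    rw [ho]
    exact neg_mem (Submodule.smul_mem _ _ (hσ' i))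
  · intro k i
    rw [ho]
    simp [h3, hCσ]

end Deformation

section QuadraticForms

variable {K n : Type*} [Field K] [Fintype n] [DecidableEq n]

/-- Two symmetric matrices `Q₁`, `Q₂` with `det Q₁ ≠ 0` for which `Q₁⁻¹ Q₂` has distinct
eigenvalues are simultaneously diagonalizable by a congruence. -/
theorem exists_congruence_isDiag [IsAlgClosed K] {Q₁ Q₂ : Matrix n n K} (h₁ : Q₁.IsSymm)
    (h₂ : Q₂.IsSymm) (hdet : Q₁.det ≠ 0) (hsep : (Q₁.adjugate * Q₂).charpoly.Separable) :
    ∃ P : Matrix n n K, IsUnit P ∧ (Pᵀ * Q₁ * P).IsDiag ∧ (Pᵀ * Q₂ * P).IsDiag := by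
  classical
  set B := Q₁.adjugate * Q₂ with hB
  have hQB : Q₁ * B = Q₁.det • Q₂ := by
    rw [hB, ← mul_assoc, Matrix.mul_adjugate, Matrix.smul_mul, one_mul]
  have hcard : B.charpoly.roots.toFinset.card = Fintype.card n := by
    rw [Multiset.toFinset_card_of_nodup (Polynomial.nodup_roots hsep),
      ← (IsAlgClosed.splits B.charpoly).natDegree_eq_card_roots]
    rw [B.charpoly_natDegree_eq_dim]
  let f : n ≃ B.charpoly.roots.toFinset := Fintype.equivOfCardEq (by simp [hcard])
  let μ : n → K := fun i => f i
  have hμ : Function.Injective μ := Subtype.val_injective.comp f.injective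
  have hev : ∀ i, ∃ v : n → K, Module.End.HasEigenvector (Matrix.toLin' B) (μ i) v := by
    intro i
    apply Module.End.HasEigenvalue.exists_hasEigenvector
    rw [Module.End.hasEigenvalue_iff_isRoot_charpoly, Matrix.charpoly_toLin']
    have := (f i).2
    rw [Multiset.mem_toFinset] at this
    exact Polynomial.isRoot_of_mem_roots this
  choose v hv using hev
  have hli := Module.End.eigenvectors_linearIndependent' (Matrix.toLin' B) μ hμ v hv
  let P : Matrix n n K := Matrix.of fun a b => v b a
  have hBP : B * P = P * diagonal μ := by
    ext a b
    have := congrFun (hv b).apply_eq_smul a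
    rw [Matrix.mul_diagonal]
    rw [Matrix.toLin'_apply] at this
    simp only [P, Matrix.mul_apply, Matrix.of_apply]
    simpa [Matrix.mulVec, dotProduct, mul_comm] using this
  have hrel : (Pᵀ * Q₁ * P) * diagonal μ = Q₁.det • (Pᵀ * Q₂ * P) := by
    rw [mul_assoc _ P, ← hBP, mul_assoc, ← mul_assoc Q₁, hQB]
    simp [mul_assoc]
  have hs₁ : (Pᵀ * Q₁ * P).IsSymm := by
    simp [Matrix.IsSymm, Matrix.transpose_mul, h₁.eq, mul_assoc]
  have hs₂ : (Pᵀ * Q₂ * P).IsSymm := by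
    simp [Matrix.IsSymm, Matrix.transpose_mul, h₂.eq, mul_assoc]
  have key : ∀ i j, i ≠ j → (Pᵀ * Q₁ * P) i j = 0 ∧ (Pᵀ * Q₂ * P) i j = 0 := by
    intro i j hij
    have e1 := congrFun (congrFun hrel i) j
    have e2 := congrFun (congrFun hrel j) i
    rw [Matrix.mul_diagonal, Matrix.smul_apply, smul_eq_mul] at e1 e2
    rw [hs₁.apply, hs₂.apply] at e2
    have e3 : (Pᵀ * Q₁ * P) i j * (μ i - μ j) = 0 := by linear_combination e2 - e1
    have e4 := (mul_eq_zero.1 e3).resolve_right (sub_ne_zero.2 (hμ.ne hij))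
    refine ⟨e4, ?_⟩
    rw [e4, zero_mul] at e1
    exact (mul_eq_zero.1 e1.symm).resolve_left hdet
  refine ⟨P, ?_, fun i j hij => (key i j hij).1, fun i j hij => (key i j hij).2⟩
  rw [← Matrix.linearIndependent_cols_iff_isUnit]
  exact hli

theorem finite_setOf_not_separable [CharZero K] (Q₁ Q₂ D : Matrix n n K)
    (hD : D.charpoly.Separable) :
    {t : K | ¬ ((Q₁ + t • (1 - Q₁)).det ≠ 0 ∧
      ((Q₁ + t • (1 - Q₁)).adjugate * (Q₂ + t • (D - Q₂))).charpoly.Separable)}.Finite := by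
  let M : Matrix n n K → Matrix n n K → Matrix n n (Polynomial K) := fun Q D =>
    Q.map Polynomial.C + (Polynomial.X : Polynomial K) • (D - Q).map Polynomial.C
  have hM : ∀ Q D t, (M Q D).map (Polynomial.evalRingHom t) = Q + t • (D - Q) := by
    intro Q D t
    ext a b
    simp [M]
  let χ := ((M Q₁ 1).adjugate * M Q₂ D).charpoly
  let N := Fintype.card n
  have hχ : ∀ t, χ.map (Polynomial.evalRingHom t) =
      ((Q₁ + t • (1 - Q₁)).adjugate * (Q₂ + t • (D - Q₂))).charpoly := by
    intro t
    rw [← hM, ← hM, ← RingHom.mapMatrix_apply, ← RingHom.map_adjugate, RingHom.mapMatrix_apply,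
      ← Matrix.map_mul, Matrix.charpoly_map]
  let ρ := Polynomial.resultant χ χ.derivative N (N - 1)
  have hρ : ∀ t, ρ.eval t ≠ 0 ↔
      ((Q₁ + t • (1 - Q₁)).adjugate * (Q₂ + t • (D - Q₂))).charpoly.Separable := by
    intro t
    have h := Polynomial.resultant_map_map χ χ.derivative N (N - 1) (Polynomial.evalRingHom t)
    rw [← Polynomial.derivative_map, hχ] at h
    set q := ((Q₁ + t • (1 - Q₁)).adjugate * (Q₂ + t • (D - Q₂))).charpoly
    have hq : q.natDegree = N := Matrix.charpoly_natDegree_eq_dim _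
    have hq' : q.derivative.natDegree = N - 1 := by rw [Polynomial.natDegree_derivative, hq]
    have hq0 : q ≠ 0 := (Matrix.charpoly_monic _).ne_zero
    have h' : Polynomial.resultant q q.derivative = ρ.eval t := by
      rw [hq, hq']; exact h
    rw [← h', Ne, Polynomial.resultant_eq_zero_iff]
    simp [hq0, Polynomial.Separable]
  let p := (M Q₁ 1).det * ρ
  have hdet : ∀ t, (M Q₁ 1).det.eval t = (Q₁ + t • (1 - Q₁)).det := by
    intro t
    rw [← hM, ← RingHom.mapMatrix_apply, ← RingHom.map_det]
    rfl
  have hp : p ≠ 0 := by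
    intro h0
    have : p.eval 1 ≠ 0 := by
      rw [Polynomial.eval_mul]
      refine mul_ne_zero ?_ ?_
      · rw [hdet]; simp
      · rw [hρ]; simpa using hD
    rw [h0] at this
    simp at this
  refine (Polynomial.finite_setOfPred_isRoot hp).subset fun t ht => ?_
  by_contra hne
  refine ht ?_
  have : p.eval t ≠ 0 := hne
  rw [Polynomial.eval_mul] at this
  exact ⟨hdet t ▸ left_ne_zero_of_mul this, (hρ t).1 (right_ne_zero_of_mul this)⟩

end QuadraticForms

section Pencil

variable {K V : Type*} [Field K] [IsAlgClosed K] [AddCommGroup V] [Module K V]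
  [Module.Finite K V] {N ι : Type*} [Fintype N] [DecidableEq N] [Fintype ι]

theorem EndClosure.of_diagonal_pencil (o : V) (e : N → V) (w : ι → V)
    (hspan : ⊤ ≤ Submodule.span K (insert o (Set.range e ∪ Set.range w)))
    (hcard : Fintype.card N + Fintype.card ι + 1 = Module.finrank K V) {T : N → Module.End K V}
    (hw : ∀ i j, ∃ μ : K, T i (w j) = μ • w j) (h1 : ∀ i, T i o = e i) (σ₁ σ₂ : V)
    (Q₁ Q₂ : Matrix N N K) (h2 : ∀ i j, T i (e j) = Q₁ i j • σ₁ + Q₂ i j • σ₂)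
    (hσ₁ : σ₁ ∈ Submodule.span K (Set.range w)) (hσ₂ : σ₂ ∈ Submodule.span K (Set.range w))
    (h3 : ∀ i, T i σ₁ = 0) (h4 : ∀ i, T i σ₂ = 0)
    (hQ : ∃ P : Matrix N N K, IsUnit P ∧ (Pᵀ * Q₁ * P).IsDiag ∧ (Pᵀ * Q₂ * P).IsDiag) :
    EndClosure T := by
  obtain ⟨P, hP, hd₁, hd₂⟩ := hQ
  obtain ⟨R, hPR⟩ : ∃ R, P * R = 1 := by
    obtain ⟨u, rfl⟩ := hP
    exact ⟨_, u.mul_inv⟩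
  have hsum : ∀ (f : N → V) j, f j = ∑ i, R i j • ∑ k, P k i • f k := by
    intro f j
    simp only [Finset.smul_sum, smul_smul]
    rw [Finset.sum_comm]
    have : ∀ k, ∑ i, (R i j * P k i) • f k = (1 : Matrix N N K) k j • f k := by
      intro k
      rw [← hPR, Matrix.mul_apply, Finset.sum_smul]
      exact Finset.sum_congr rfl fun i _ => by rw [mul_comm]
    simp only [this]
    simp [Matrix.one_apply]
  let e' : N → V := fun i => ∑ k, P k i • e k
  let T' : N → Module.End K V := fun i => ∑ k, P k i • T k
  have hmain : EndClosure T' := by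
    refine EndClosure.of_diagonal_squares o e' w ?_ hcard ?_ ?_
      (fun i => (Pᵀ * Q₁ * P) i i • σ₁ + (Pᵀ * Q₂ * P) i i • σ₂) ?_ ?_ ?_
    · refine hspan.trans (Submodule.span_le.2 ?_)
      rintro x (rfl | ⟨j, rfl⟩ | ⟨j, rfl⟩)
      · exact Submodule.subset_span (Set.mem_insert _ _)
      · rw [SetLike.mem_coe, hsum e j]
        exact Submodule.sum_mem _ fun i _ => Submodule.smul_mem _ _
          (Submodule.subset_span (Set.mem_insert_of_mem _ (Or.inl ⟨i, rfl⟩)))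
      · exact Submodule.subset_span (Set.mem_insert_of_mem _ (Or.inr ⟨j, rfl⟩))
    · intro i j
      choose μ hμ using fun i => hw i j
      refine ⟨∑ k, P k i * μ k, ?_⟩
      simp [T', hμ, smul_smul, Finset.sum_smul]
    · intro i
      simp [T', e', h1]
    · intro i j
      have : T' i (e' j) = (Pᵀ * Q₁ * P) i j • σ₁ + (Pᵀ * Q₂ * P) i j • σ₂ := by
        simp only [T', e', map_sum, map_smul, LinearMap.sum_apply, LinearMap.smul_apply, h2,
          Matrix.mul_apply, Finset.sum_smul, smul_add, smul_smul, Finset.smul_sum,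
          Finset.sum_add_distrib, Matrix.transpose_apply, Finset.sum_mul]
        congr 1
        all_goals
          refine Finset.sum_congr rfl fun a _ => Finset.sum_congr rfl fun c _ => ?_
          congr 1
          ring
      rw [this]
      split_ifs with h
      · rw [h]
      · rw [hd₁ h, hd₂ h]
        simp
    · exact fun i => add_mem (Submodule.smul_mem _ _ hσ₁) (Submodule.smul_mem _ _ hσ₂)
    · intro i j
      simp [T', h3, h4]
  refine hmain.of_mem_adjoin fun j => ?_
  have : T j = ∑ i, R i j • T' i := by
    ext x
    have := hsum (fun k => T k x) j
    simpa [T'] using this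
  rw [this]
  exact Subalgebra.sum_mem _ fun i _ => Subalgebra.smul_mem _ (Algebra.subset_adjoin (Set.mem_range_self i)) _

/-- The coordinate ring of a set of points together with an algebra with Hilbert function
`(1, n, 2)` or `(1, n, 1)` is a limit of coordinate rings of points. -/
theorem EndClosure.of_pencil [CharZero K] (o : V) (e : N → V) (w : ι → V)
    (hspan : ⊤ ≤ Submodule.span K (insert o (Set.range e ∪ Set.range w)))
    (hcard : Fintype.card N + Fintype.card ι + 1 = Module.finrank K V) {T : N → Module.End K V}
    (hw : ∀ i j, ∃ μ : K, T i (w j) = μ • w j) (h1 : ∀ i, T i o = e i) (σ₁ σ₂ : V)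
    (Q₁ Q₂ : Matrix N N K) (hQ₁ : Q₁.IsSymm) (hQ₂ : Q₂.IsSymm)
    (h2 : ∀ i j, T i (e j) = Q₁ i j • σ₁ + Q₂ i j • σ₂)
    (hσ₁ : σ₁ ∈ Submodule.span K (Set.range w)) (hσ₂ : σ₂ ∈ Submodule.span K (Set.range w))
    (h3 : ∀ i, T i σ₁ = 0) (h4 : ∀ i, T i σ₂ = 0) :
    EndClosure T := by
  let b : Module.Basis (Option (N ⊕ ι)) K V := basisOfTopLeSpanOfCardEqFinrank
    (fun x => x.elim o (Sum.elim e w)) (by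
      refine hspan.trans (Submodule.span_mono ?_)
      rintro x (rfl | ⟨j, rfl⟩ | ⟨j, rfl⟩)
      · exact ⟨none, rfl⟩
      · exact ⟨some (.inl j), rfl⟩
      · exact ⟨some (.inr j), rfl⟩) (by rw [Fintype.card_option, Fintype.card_sum, hcard])
  have hb0 : b none = o := by simp [b]
  have hbe : ∀ j, b (some (.inl j)) = e j := by simp [b]
  have hbw : ∀ j, b (some (.inr j)) = w j := by simp [b]
  let D : Matrix N N K := diagonal fun i => ((Fintype.equivFin N i : ℕ) : K)
  have hD : D.charpoly.Separable := by
    rw [Matrix.charpoly_diagonal, Polynomial.separable_prod_X_sub_C_iff]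
    intro i j hij
    exact (Fintype.equivFin N).injective (Fin.val_injective (Nat.cast_injective hij))
  let C : N → Module.End K V := fun i => b.constr K fun x => x.elim 0
    (Sum.elim (fun j => (1 - Q₁) i j • σ₁ + (D - Q₂) i j • σ₂) 0)
  have hC0 : ∀ i, C i o = 0 := fun i => by
    rw [← hb0]; simp only [C]; rw [b.constr_basis]; rfl
  have hCe : ∀ i j, C i (e j) = (1 - Q₁) i j • σ₁ + (D - Q₂) i j • σ₂ := fun i j => by
    rw [← hbe]; simp only [C]; rw [b.constr_basis]; simp
  have hCw : ∀ i j, C i (w j) = 0 := fun i j => by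
    rw [← hbw]; simp only [C]; rw [b.constr_basis]; simp
  have hCσ : ∀ i, ∀ σ ∈ Submodule.span K (Set.range w), C i σ = 0 := fun i => by
    have : Submodule.span K (Set.range w) ≤ LinearMap.ker (C i) := by
      rw [Submodule.span_le]
      rintro _ ⟨k, rfl⟩
      exact hCw i k
    exact fun σ hσ => this hσ
  refine EndClosure.of_finite (C := C) _ (finite_setOf_not_separable Q₁ Q₂ D hD) fun t ht => ?_
  rw [Set.mem_ofPred_eq, not_not] at ht
  have hDs : D.IsSymm := by simp [D, Matrix.IsSymm]
  refine EndClosure.of_diagonal_pencil o e w hspan hcard ?_ ?_ σ₁ σ₂ (Q₁ + t • (1 - Q₁))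
    (Q₂ + t • (D - Q₂)) ?_ hσ₁ hσ₂ ?_ ?_ (exists_congruence_isDiag ?_ ?_ ht.1 ht.2)
  · intro i j
    obtain ⟨μ, hμ⟩ := hw i j
    exact ⟨μ, by simp [hμ, hCw]⟩
  · intro i
    simp [h1, hC0]
  · intro i j
    simp only [LinearMap.add_apply, LinearMap.smul_apply, h2, hCe, Matrix.add_apply,
      Matrix.smul_apply, smul_eq_mul]
    module
  · intro i
    simp [h3, hCσ i _ hσ₁]
  · intro i
    simp [h4, hCσ i _ hσ₂]
  · exact hQ₁.add ((Matrix.isSymm_one.sub hQ₁).smul t)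
  · exact hQ₂.add ((hDs.sub hQ₂).smul t)

end Pencil

section TwoChains

variable {K R : Type*} [Field K] [CommRing R] [Algebra K R]
  [Module.Finite K R]

theorem mem_of_eq_comb {V : Type*} [AddCommGroup V] [Module K V] {S : Submodule K V}
    {x u₁ u₂ u₃ u₄ : V} (h₁ : u₁ ∈ S) (h₂ : u₂ ∈ S) (h₃ : u₃ ∈ S) (h₄ : u₄ ∈ S) (a b c d : K)
    (h : x = a • u₁ + b • u₂ + c • u₃ + d • u₄) : x ∈ S := by
  rw [h]
  exact add_mem (add_mem (add_mem (S.smul_mem _ h₁) (S.smul_mem _ h₂)) (S.smul_mem _ h₃))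
    (S.smul_mem _ h₄)

theorem exists_end_of_span {V : Type*} [AddCommGroup V] [Module K V] {n : ℕ} (v : Fin n → V)
    (hv : ⊤ ≤ Submodule.span K (Set.range v)) (hn : Module.finrank K V = n) (f : Fin n → V) :
    ∃ C : Module.End K V, ∀ i, C (v i) = f i := by
  let b := basisOfTopLeSpanOfCardEqFinrank v hv (by simp [hn])
  refine ⟨b.constr K f, fun i => ?_⟩
  have := b.constr_basis K f i
  simpa [b] using this

set_option maxHeartbeats 2000000 in
theorem endClosure_of_two_chains_of_pow_eq_zero [CharZero K] [IsAlgClosed K]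
    (hR : Module.finrank K R = 10) (p q z w s : R)
    (hspan : ⊤ ≤ Submodule.span K
      (Set.range ![1, p, p ^ 2, p ^ 3, q, q ^ 2, q ^ 3, s, z, w]))
    (hpq : p * q = 0) {κ : K} (hq : q ^ 4 = κ • s) (hp : p ^ 4 = 0)
    (hps : p * s = 0) (hqs : q * s = 0) (hzs : z * s = 0) (hws : w * s = 0)
    {α β : Fin 7 → K}
    (hzp : z * p = α 0 • p ^ 3 + β 0 • s) (hzq : z * q = α 1 • p ^ 3 + β 1 • s)
    (hwp : w * p = α 2 • p ^ 3 + β 2 • s) (hwq : w * q = α 3 • p ^ 3 + β 3 • s)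
    (hzz : z * z = α 4 • p ^ 3 + β 4 • s) (hzw : z * w = α 5 • p ^ 3 + β 5 • s)
    (hww : w * w = α 6 • p ^ 3 + β 6 • s) :
    EndClosure fun i => LinearMap.mulLeft K (![p, q, z, w] i) := by
  obtain ⟨C, hC⟩ := exists_end_of_span _ hspan hR ![0, 0, p ^ 2, 0, 0, 0, 0, 0, 0, 0]
  obtain ⟨D, hD⟩ := exists_end_of_span _ hspan hR
    ![0, 0, 0, 0, 0, q ^ 2, (2 : K) • q ^ 3, 0, 0, 0]
  have hC1 : C 1 = 0 := hC 0
  have hCp : C p = 0 := hC 1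
  have hCp2 : C (p ^ 2) = p ^ 2 := hC 2
  have hCp3 : C (p ^ 3) = 0 := hC 3
  have hCq : C q = 0 := hC 4
  have hCq2 : C (q ^ 2) = 0 := hC 5
  have hCq3 : C (q ^ 3) = 0 := hC 6
  have hCs : C s = 0 := hC 7
  have hCz : C z = 0 := hC 8
  have hCw : C w = 0 := hC 9
  have hD1 : D 1 = 0 := hD 0
  have hDp : D p = 0 := hD 1
  have hDp2 : D (p ^ 2) = 0 := hD 2
  have hDp3 : D (p ^ 3) = 0 := hD 3
  have hDq : D q = 0 := hD 4
  have hDq2 : D (q ^ 2) = q ^ 2 := hD 5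
  have hDq3 : D (q ^ 3) = (2 : K) • q ^ 3 := hD 6
  have hDs : D s = 0 := hD 7
  have hDz : D z = 0 := hD 8
  have hDw : D w = 0 := hD 9
  have hzp2 : z * p ^ 2 = 0 := by
    rw [pow_two, ← mul_assoc, hzp, Algebra.smul_def, Algebra.smul_def]
    linear_combination algebraMap K R (α 0) * hp + algebraMap K R (β 0) * hps
  have hwp2 : w * p ^ 2 = 0 := by
    rw [pow_two, ← mul_assoc, hwp, Algebra.smul_def, Algebra.smul_def]
    linear_combination algebraMap K R (α 2) * hp + algebraMap K R (β 2) * hps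
  have hzq2 : z * q ^ 2 = 0 := by
    rw [pow_two, ← mul_assoc, hzq, Algebra.smul_def, Algebra.smul_def]
    linear_combination algebraMap K R (α 1) * p ^ 2 * hpq + algebraMap K R (β 1) * hqs
  have hwq2 : w * q ^ 2 = 0 := by
    rw [pow_two, ← mul_assoc, hwq, Algebra.smul_def, Algebra.smul_def]
    linear_combination algebraMap K R (α 3) * p ^ 2 * hpq + algebraMap K R (β 3) * hqs
  have hpp3 : p * p ^ 3 = 0 := by linear_combination hp
  have hqp3 : q * p ^ 3 = 0 := by linear_combination p ^ 2 * hpq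
  have hzp3 : z * p ^ 3 = 0 := by linear_combination p * hzp2
  have hwp3 : w * p ^ 3 = 0 := by linear_combination p * hwp2
  refine EndClosure.of_finite (C := ![C, D, 0, 0]) {0} (Set.finite_singleton 0) fun t ht => ?_
  obtain ⟨r, hr⟩ : ∃ r : K, t * r = 1 := ⟨t⁻¹, mul_inv_cancel₀ ht⟩
  obtain ⟨c, hc⟩ : ∃ c : K, c * 2 = 1 := ⟨2⁻¹, inv_mul_cancel₀ two_ne_zero⟩
  have hr' : algebraMap K R t * algebraMap K R r = 1 := by rw [← map_mul, hr, map_one]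
  have hc' : algebraMap K R c * 2 = 1 := by
    have := congrArg (algebraMap K R) hc
    rwa [map_mul, map_one, map_ofNat] at this
  have hT : ∀ i x, (LinearMap.mulLeft K (![p, q, z, w] i) + t • ![C, D, 0, 0] i) x =
      ![p * x + t • C x, q * x + t • D x, z * x, w * x] i := by
    intro i x
    fin_cases i <;> simp
  simp only [Algebra.smul_def] at hq hzp hzq hwp hwq hzz hzw hww
  clear hD hC
  let o := 1 - r ^ 2 • q ^ 2 + (3 * c ^ 2 * r ^ 3) • q ^ 3 - r ^ 2 • p ^ 2
  let p' := p - r • p ^ 2 - r ^ 2 • p ^ 3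
  let q' := q - r • q ^ 2 + (c * r ^ 2) • q ^ 3 + (3 * c ^ 2 * r ^ 3 * κ) • s
  let P₁ := p ^ 2 + r • p ^ 3
  let P₂ := q ^ 2 - r • q ^ 3 - (κ * r ^ 2) • s
  let P₃ := q ^ 3 + (κ * c * r) • s
  refine EndClosure.of_pencil o ![p', q', z, w] ![p ^ 3, s, P₁, P₂, P₃] ?_ (by simp [hR]) ?_ ?_
    (p ^ 3) s !![-r, 0, α 0, α 2; 0, 0, α 1, α 3; α 0, α 1, α 4, α 5; α 2, α 3, α 5, α 6]
    !![0, 0, β 0, β 2; 0, κ * c * r ^ 2, β 1, β 3; β 0, β 1, β 4, β 5; β 2, β 3, β 5, β 6]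
    ?_ ?_ ?_ ?_ ?_ ?_ ?_
  · refine hspan.trans (Submodule.span_le.2 ?_)
    obtain ⟨S, hS⟩ : ∃ S : Submodule K R, Submodule.span K (insert o (Set.range ![p', q', z, w] ∪
        Set.range ![p ^ 3, s, P₁, P₂, P₃])) = S := ⟨_, rfl⟩
    rw [hS]
    have ho : o ∈ S := hS ▸ Submodule.subset_span (Or.inl rfl)
    have he : ∀ i, ![p', q', z, w] i ∈ S := fun i =>
      hS ▸ Submodule.subset_span (Or.inr (Or.inl ⟨i, rfl⟩))
    have hw : ∀ i, ![p ^ 3, s, P₁, P₂, P₃] i ∈ S := fun i =>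
      hS ▸ Submodule.subset_span (Or.inr (Or.inr ⟨i, rfl⟩))
    have m0 : (0 : R) ∈ S := zero_mem S
    have mp3 : p ^ 3 ∈ S := hw 0
    have ms : s ∈ S := hw 1
    have mp2 : p ^ 2 ∈ S := mem_of_eq_comb (hw 2) mp3 m0 m0 1 (-r) 0 0 (by
      simp only [Matrix.cons_val, P₁]; module)
    have mq3 : q ^ 3 ∈ S := mem_of_eq_comb (hw 4) ms m0 m0 1 (-(κ * c * r)) 0 0 (by
      simp only [Matrix.cons_val, P₃]; module)
    have mq2 : q ^ 2 ∈ S := mem_of_eq_comb (hw 3) mq3 ms m0 1 r (κ * r ^ 2) 0 (by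
      simp only [Matrix.cons_val, P₂]; module)
    have mp : p ∈ S := mem_of_eq_comb (he 0) mp2 mp3 m0 1 r (r ^ 2) 0 (by
      simp only [Matrix.cons_val, p']; module)
    have mq : q ∈ S := mem_of_eq_comb (he 1) mq2 mq3 ms 1 r (-(c * r ^ 2))
      (-(3 * c ^ 2 * r ^ 3 * κ)) (by simp only [Matrix.cons_val, q']; module)
    have m1 : (1 : R) ∈ S := mem_of_eq_comb ho mq2 mq3 mp2 1 (r ^ 2) (-(3 * c ^ 2 * r ^ 3))
      (r ^ 2) (by simp only [o]; module)
    rintro _ ⟨i, rfl⟩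
    fin_cases i
    exacts [m1, mp, mp2, mp3, mq, mq2, mq3, ms, he 2, he 3]
  · intro i j
    refine ⟨!![0, 0, t, 0, 0; 0, 0, 0, t, 2 * t; 0, 0, 0, 0, 0; 0, 0, 0, 0, 0] i j, ?_⟩
    rw [hT]
    fin_cases i <;> fin_cases j <;>
      simp [P₁, P₂, P₃, *, -algebraMap_smul] <;>
      (try simp only [Algebra.smul_def, map_mul, map_pow, map_ofNat]) <;>
      clear hT <;> grind
  · intro i
    rw [hT]
    fin_cases i <;>
      simp [o, p', q', *, -algebraMap_smul] <;>
      (try simp only [Algebra.smul_def, map_mul, map_pow, map_ofNat]) <;>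
      clear hT <;> grind
  · ext i j
    fin_cases i <;> fin_cases j <;> rfl
  · ext i j
    fin_cases i <;> fin_cases j <;> rfl
  · intro i j
    rw [hT]
    fin_cases i <;> fin_cases j <;>
      simp [p', q', *, -algebraMap_smul] <;>
      (try simp only [Algebra.smul_def, map_mul, map_pow, map_ofNat]) <;>
      clear hT <;> grind
  · exact Submodule.subset_span ⟨0, rfl⟩
  · exact Submodule.subset_span ⟨1, rfl⟩
  · intro i
    rw [hT]
    fin_cases i <;> simp [*]
  · intro i
    rw [hT]
    fin_cases i <;> simp [*]

set_option maxHeartbeats 2000000 in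
theorem endClosure_of_two_chains [CharZero K] [IsAlgClosed K]
    (hR : Module.finrank K R = 10) (p q z w s : R)
    (hspan : ⊤ ≤ Submodule.span K
      (Set.range ![1, p, p ^ 2, p ^ 3, q, q ^ 2, q ^ 3, s, z, w]))
    (hpq : p * q = 0) {κ μ : K} (hq : q ^ 4 = κ • s) (hp : p ^ 4 = μ • s)
    (hps : p * s = 0) (hqs : q * s = 0) (hzs : z * s = 0) (hws : w * s = 0)
    {β : Fin 7 → K}
    (hzp : z * p = β 0 • s) (hzq : z * q = β 1 • s)
    (hwp : w * p = β 2 • s) (hwq : w * q = β 3 • s)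
    (hzz : z * z = β 4 • s) (hzw : z * w = β 5 • s)
    (hww : w * w = β 6 • s) :
    EndClosure fun i => LinearMap.mulLeft K (![p, q, z, w] i) := by
  obtain ⟨C, hC⟩ := exists_end_of_span _ hspan hR
    ![0, 0, p ^ 2, (2 : K) • p ^ 3, 0, 0, 0, 0, 0, 0]
  obtain ⟨D, hD⟩ := exists_end_of_span _ hspan hR
    ![0, 0, 0, 0, 0, q ^ 2, (2 : K) • q ^ 3, 0, 0, 0]
  have hC1 : C 1 = 0 := hC 0
  have hCp : C p = 0 := hC 1
  have hCp2 : C (p ^ 2) = p ^ 2 := hC 2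
  have hCp3 : C (p ^ 3) = (2 : K) • p ^ 3 := hC 3
  have hCq : C q = 0 := hC 4
  have hCq2 : C (q ^ 2) = 0 := hC 5
  have hCq3 : C (q ^ 3) = 0 := hC 6
  have hCs : C s = 0 := hC 7
  have hCz : C z = 0 := hC 8
  have hCw : C w = 0 := hC 9
  have hD1 : D 1 = 0 := hD 0
  have hDp : D p = 0 := hD 1
  have hDp2 : D (p ^ 2) = 0 := hD 2
  have hDp3 : D (p ^ 3) = 0 := hD 3
  have hDq : D q = 0 := hD 4
  have hDq2 : D (q ^ 2) = q ^ 2 := hD 5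
  have hDq3 : D (q ^ 3) = (2 : K) • q ^ 3 := hD 6
  have hDs : D s = 0 := hD 7
  have hDz : D z = 0 := hD 8
  have hDw : D w = 0 := hD 9
  have hzp2 : z * p ^ 2 = 0 := by
    rw [pow_two, ← mul_assoc, hzp, Algebra.smul_def]
    linear_combination algebraMap K R (β 0) * hps
  have hzq2 : z * q ^ 2 = 0 := by
    rw [pow_two, ← mul_assoc, hzq, Algebra.smul_def]
    linear_combination algebraMap K R (β 1) * hqs
  have hwp2 : w * p ^ 2 = 0 := by
    rw [pow_two, ← mul_assoc, hwp, Algebra.smul_def]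
    linear_combination algebraMap K R (β 2) * hps
  have hwq2 : w * q ^ 2 = 0 := by
    rw [pow_two, ← mul_assoc, hwq, Algebra.smul_def]
    linear_combination algebraMap K R (β 3) * hqs
  refine EndClosure.of_finite (C := ![C, D, 0, 0]) {0} (Set.finite_singleton 0) fun t ht => ?_
  obtain ⟨r, hr⟩ : ∃ r : K, t * r = 1 := ⟨t⁻¹, mul_inv_cancel₀ ht⟩
  obtain ⟨c, hc⟩ : ∃ c : K, c * 2 = 1 := ⟨2⁻¹, inv_mul_cancel₀ two_ne_zero⟩
  have hr' : algebraMap K R t * algebraMap K R r = 1 := by rw [← map_mul, hr, map_one]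
  have hc' : algebraMap K R c * 2 = 1 := by
    have := congrArg (algebraMap K R) hc
    rwa [map_mul, map_one, map_ofNat] at this
  have hT : ∀ i x, (LinearMap.mulLeft K (![p, q, z, w] i) + t • ![C, D, 0, 0] i) x =
      ![p * x + t • C x, q * x + t • D x, z * x, w * x] i := by
    intro i x
    fin_cases i <;> simp
  simp only [Algebra.smul_def] at hq hp hzp hzq hwp hwq hzz hzw hww
  clear hD hC
  let o := 1 - r ^ 2 • q ^ 2 + (3 * c ^ 2 * r ^ 3) • q ^ 3 - r ^ 2 • p ^ 2 +
    (3 * c ^ 2 * r ^ 3) • p ^ 3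
  let p' := p - r • p ^ 2 + (c * r ^ 2) • p ^ 3 + (3 * c ^ 2 * r ^ 3 * μ) • s
  let q' := q - r • q ^ 2 + (c * r ^ 2) • q ^ 3 + (3 * c ^ 2 * r ^ 3 * κ) • s
  let P₁ := p ^ 2 - r • p ^ 3 - (μ * r ^ 2) • s
  let P₂ := p ^ 3 + (μ * c * r) • s
  let P₃ := q ^ 2 - r • q ^ 3 - (κ * r ^ 2) • s
  let P₄ := q ^ 3 + (κ * c * r) • s
  refine EndClosure.of_pencil o ![p', q', z, w] ![s, P₁, P₂, P₃, P₄] ?_ (by simp [hR]) ?_ ?_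
    s 0 !![μ * c * r ^ 2, 0, β 0, β 2; 0, κ * c * r ^ 2, β 1, β 3;
      β 0, β 1, β 4, β 5; β 2, β 3, β 5, β 6] 0 ?_ ?_ ?_ ?_ ?_ ?_ ?_
  · refine hspan.trans (Submodule.span_le.2 ?_)
    obtain ⟨S, hS⟩ : ∃ S : Submodule K R, Submodule.span K (insert o (Set.range ![p', q', z, w] ∪
        Set.range ![s, P₁, P₂, P₃, P₄])) = S := ⟨_, rfl⟩
    rw [hS]
    have ho : o ∈ S := hS ▸ Submodule.subset_span (Or.inl rfl)
    have he : ∀ i, ![p', q', z, w] i ∈ S := fun i =>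
      hS ▸ Submodule.subset_span (Or.inr (Or.inl ⟨i, rfl⟩))
    have hw : ∀ i, ![s, P₁, P₂, P₃, P₄] i ∈ S := fun i =>
      hS ▸ Submodule.subset_span (Or.inr (Or.inr ⟨i, rfl⟩))
    have m0 : (0 : R) ∈ S := zero_mem S
    have ms : s ∈ S := hw 0
    have mp3 : p ^ 3 ∈ S := mem_of_eq_comb (hw 2) ms m0 m0 1 (-(μ * c * r)) 0 0 (by
      simp only [Matrix.cons_val, P₂]; module)
    have mp2 : p ^ 2 ∈ S := mem_of_eq_comb (hw 1) mp3 ms m0 1 r (μ * r ^ 2) 0 (by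
      simp only [Matrix.cons_val, P₁]; module)
    have mq3 : q ^ 3 ∈ S := mem_of_eq_comb (hw 4) ms m0 m0 1 (-(κ * c * r)) 0 0 (by
      simp only [Matrix.cons_val, P₄]; module)
    have mq2 : q ^ 2 ∈ S := mem_of_eq_comb (hw 3) mq3 ms m0 1 r (κ * r ^ 2) 0 (by
      simp only [Matrix.cons_val, P₃]; module)
    have mp : p ∈ S := mem_of_eq_comb (he 0) mp2 mp3 ms 1 r (-(c * r ^ 2))
      (-(3 * c ^ 2 * r ^ 3 * μ)) (by simp only [Matrix.cons_val, p']; module)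
    have mq : q ∈ S := mem_of_eq_comb (he 1) mq2 mq3 ms 1 r (-(c * r ^ 2))
      (-(3 * c ^ 2 * r ^ 3 * κ)) (by simp only [Matrix.cons_val, q']; module)
    have m1 : (1 : R) ∈ S := mem_of_eq_comb (mem_of_eq_comb ho mq2 mq3 mp2 1 (r ^ 2)
      (-(3 * c ^ 2 * r ^ 3)) (r ^ 2) rfl) mp3 m0 m0 1 (-(3 * c ^ 2 * r ^ 3)) 0 0
      (by simp only [o]; module)
    rintro _ ⟨i, rfl⟩
    fin_cases i
    exacts [m1, mp, mp2, mp3, mq, mq2, mq3, ms, he 2, he 3]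
  · intro i j
    refine ⟨!![0, t, 2 * t, 0, 0; 0, 0, 0, t, 2 * t; 0, 0, 0, 0, 0; 0, 0, 0, 0, 0] i j, ?_⟩
    rw [hT]
    fin_cases i <;> fin_cases j <;>
      simp [P₁, P₂, P₃, P₄, *, -algebraMap_smul] <;>
      (try simp only [Algebra.smul_def, map_mul, map_pow, map_ofNat]) <;>
      clear hT <;> grind
  · intro i
    rw [hT]
    fin_cases i <;>
      simp [o, p', q', *, -algebraMap_smul] <;>
      (try simp only [Algebra.smul_def, map_mul, map_pow, map_ofNat]) <;>
      clear hT <;> grind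
  · ext i j
    fin_cases i <;> fin_cases j <;> rfl
  · exact Matrix.isSymm_zero
  · intro i j
    rw [hT]
    fin_cases i <;> fin_cases j <;>
      simp [p', q', *, -algebraMap_smul] <;>
      (try simp only [Algebra.smul_def, map_mul, map_pow, map_ofNat]) <;>
      clear hT <;> grind
  · exact Submodule.subset_span ⟨0, rfl⟩
  · exact zero_mem _
  · intro i
    rw [hT]
    fin_cases i <;> simp [*]
  · exact fun i => map_zero _

end TwoChains

section NormalForm

variable {K R : Type*} [Field K] [CommRing R] [Algebra K R]

theorem EndClosure.mulLeft_of_adjoin_eq_top [Module.Finite K R] {N N' : Type*} {m : N → R}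
    (h : EndClosure fun i => LinearMap.mulLeft K (m i)) (hm : Algebra.adjoin K (Set.range m) = ⊤)
    (m' : N' → R) : EndClosure fun i => LinearMap.mulLeft K (m' i) := by
  refine h.of_mem_adjoin fun i => ?_
  have h1 : Algebra.lmul K R (m' i) ∈ (Algebra.adjoin K (Set.range m)).map (Algebra.lmul K R) :=
    Subalgebra.mem_map.2 ⟨_, hm ▸ Algebra.mem_top, rfl⟩
  rw [AlgHom.map_adjoin, ← Set.range_comp] at h1
  exact h1

/-- Generators `x, y, z, w` of a local algebra with Hilbert function `(1, 4, 2, 2, 1)` satisfying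
relations of a standard shape. -/
structure IsNormal (x y z w : R) (δ τ a b c : K) (g f : Fin 5 → K) : Prop where
  span : ⊤ ≤ Submodule.span K
    (Set.range ![1, x, x ^ 2, x ^ 3, x ^ 4, y, x * y, x ^ 2 * y, z, w])
  mul_xz : x * z = 0
  mul_xw : x * w = 0
  pow_x : x ^ 5 = 0
  mul_x3y : x ^ 3 * y = τ • x ^ 4
  mul_yy : y * y = δ • (x * y) + a • x ^ 3 + b • (x ^ 2 * y) + c • x ^ 4
  mul_zy : z * y = g 0 • (x ^ 2 * y) + f 0 • x ^ 4
  mul_wy : w * y = g 1 • (x ^ 2 * y) + f 1 • x ^ 4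
  mul_zz : z * z = g 2 • (x ^ 2 * y) + f 2 • x ^ 4
  mul_zw : z * w = g 3 • (x ^ 2 * y) + f 3 • x ^ 4
  mul_ww : w * w = g 4 • (x ^ 2 * y) + f 4 • x ^ 4
  coeff : ∀ i, g i * τ = 0

theorem adjoin_eq_top_of_span {N ι : Type*} (m : N → R) (v : ι → R)
    (hv : ⊤ ≤ Submodule.span K (Set.range v)) (h : ∀ i, v i ∈ Algebra.adjoin K (Set.range m)) :
    Algebra.adjoin K (Set.range m) = ⊤ := by
  rw [eq_top_iff]
  intro u _
  have : Submodule.span K (Set.range v) ≤ Subalgebra.toSubmodule (Algebra.adjoin K (Set.range m)) :=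
    Submodule.span_le.2 (by rintro _ ⟨i, rfl⟩; exact h i)
  exact this (hv Submodule.mem_top)

theorem IsNormal.adjoin_eq_top {x y z w : R} {δ τ a b c : K} {g f : Fin 5 → K}
    (h : IsNormal x y z w δ τ a b c g f) : Algebra.adjoin K (Set.range ![x, y, z, w]) = ⊤ := by
  refine adjoin_eq_top_of_span _ _ h.span fun i => ?_
  generalize hS : Algebra.adjoin K (Set.range ![x, y, z, w]) = S
  have hm : ∀ i, ![x, y, z, w] i ∈ S := fun i => hS ▸ Algebra.subset_adjoin ⟨i, rfl⟩
  have hx : x ∈ S := hm 0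
  have hy : y ∈ S := hm 1
  fin_cases i
  exacts [one_mem S, hx, pow_mem hx _, pow_mem hx _, pow_mem hx _, hy, mul_mem hx hy,
    mul_mem (pow_mem hx _) hy, hm 2, hm 3]

theorem IsNormal.endClosure_of_generic [CharZero K] [IsAlgClosed K] [Module.Finite K R]
    (hR : Module.finrank K R = 10) {x y z w : R} {δ τ a b c : K} {g f : Fin 5 → K}
    (h : IsNormal x y z w δ τ a b c g f) (hδ : δ ≠ 0) (hδτ : δ ≠ 2 * τ) :
    EndClosure fun i => LinearMap.mulLeft K (![x, y, z, w] i) := by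
  obtain ⟨span, mul_xz, mul_xw, pow_x, mul_x3y, mul_yy, mul_zy, mul_wy, mul_zz, mul_zw, mul_ww,
    coeff⟩ := h
  obtain ⟨d, hd⟩ : ∃ d, d * δ = 1 := ⟨δ⁻¹, inv_mul_cancel₀ hδ⟩
  obtain ⟨u, hu⟩ : ∃ u, u * δ = a := ⟨a * d, by rw [mul_assoc, hd, mul_one]⟩
  obtain ⟨e, he⟩ : ∃ e, e = b + 2 * u := ⟨_, rfl⟩
  obtain ⟨u', hu'⟩ : ∃ u', u' * (δ - 2 * τ) = c + u ^ 2 - e * u :=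
    ⟨(c + u ^ 2 - e * u) / (δ - 2 * τ), div_mul_cancel₀ _ (sub_ne_zero.2 hδτ)⟩
  have Hd := congrArg (algebraMap K R) hd
  have Hu := congrArg (algebraMap K R) hu
  have He := congrArg (algebraMap K R) he
  have Hu' := congrArg (algebraMap K R) hu'
  simp only [Algebra.smul_def] at mul_x3y mul_yy mul_zy mul_wy mul_zz mul_zw mul_ww
  simp only [map_mul, map_add, map_sub, map_pow, map_one, map_ofNat] at Hd Hu He Hu'
  obtain ⟨p, hp⟩ : ∃ p, p = y + u • x ^ 2 + u' • x ^ 3 := ⟨_, rfl⟩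
  obtain ⟨q, hq⟩ : ∃ q, q = p - δ • x - e • x ^ 2 := ⟨_, rfl⟩
  simp only [Algebra.smul_def] at hp hq
  have hpq : p * q = 0 := by
    rw [hq, hp]
    linear_combination mul_yy - x ^ 2 * y * He + 2 * algebraMap K R u' * mul_x3y - x ^ 3 * Hu -
      x ^ 4 * Hu' + (2 * algebraMap K R u * algebraMap K R u' - algebraMap K R u' * algebraMap K R e
        + algebraMap K R u' ^ 2 * x) * pow_x
  have hxp : x * p = x * y + u • x ^ 3 + u' • x ^ 4 := by
    rw [hp, Algebra.smul_def, Algebra.smul_def]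
    ring
  have hx2p : x ^ 2 * p = x ^ 2 * y + u • x ^ 4 := by
    rw [hp, Algebra.smul_def]
    linear_combination algebraMap K R u' * pow_x
  have hx3p : x ^ 3 * p = τ • x ^ 4 := by
    rw [hp, Algebra.smul_def]
    linear_combination (algebraMap K R u + algebraMap K R u' * x) * pow_x + mul_x3y
  have hx2q : x ^ 2 * q = x ^ 2 * y + (u - e) • x ^ 4 - δ • x ^ 3 := by
    rw [hq]
    rw [mul_sub, mul_sub, hx2p]
    simp only [Algebra.smul_def, map_sub]
    ring
  have hx3q : x ^ 3 * q = (τ - δ) • x ^ 4 := by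
    rw [hq]
    rw [mul_sub, mul_sub, hx3p]
    simp only [Algebra.smul_def, map_sub]
    linear_combination (-algebraMap K R e) * pow_x
  simp only [Algebra.smul_def, map_sub] at hxp hx2p hx3p hx2q hx3q
  have hp2 : p ^ 2 = δ • (x * p) + e • (x ^ 2 * p) := by
    simp only [Algebra.smul_def]
    linear_combination hpq - p * hq
  have hq2 : q ^ 2 = - (δ • (x * q) + e • (x ^ 2 * q)) := by
    simp only [Algebra.smul_def]
    linear_combination hpq + q * hq
  simp only [Algebra.smul_def] at hp2 hq2
  obtain ⟨l, hl⟩ : ∃ l, l = algebraMap K R δ + algebraMap K R e * x := ⟨_, rfl⟩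
  obtain ⟨ε, hε⟩ : ∃ ε, ε = 3 * algebraMap K R δ ^ 2 * algebraMap K R e +
    3 * algebraMap K R δ * algebraMap K R e ^ 2 * x + algebraMap K R e ^ 3 * x ^ 2 := ⟨_, rfl⟩
  have hl3 : l ^ 3 = algebraMap K R δ ^ 3 + ε * x := by rw [hl, hε]; ring
  have hp2' : p ^ 2 = l * x * p := by rw [hp2, hl]; ring
  have hq2' : q ^ 2 = -(l * x * q) := by rw [hq2, hl]; ring
  have hp3 : p ^ 3 = δ ^ 2 • (x ^ 2 * y) + (δ ^ 2 * u + 2 * δ * e * τ) • x ^ 4 := by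
    have : p ^ 3 = l ^ 2 * (x ^ 2 * p) := by linear_combination (p + l * x) * hp2'
    rw [this, hl]
    simp only [Algebra.smul_def, map_add, map_mul, map_pow, map_ofNat]
    linear_combination algebraMap K R δ ^ 2 * hx2p +
      (2 * algebraMap K R δ * algebraMap K R e + algebraMap K R e ^ 2 * x) * hx3p +
      algebraMap K R e ^ 2 * algebraMap K R τ * pow_x
  have hq3 : q ^ 3 = δ ^ 2 • (x ^ 2 * y) - δ ^ 3 • x ^ 3 +
      (δ ^ 2 * (u - e) + 2 * δ * e * (τ - δ)) • x ^ 4 := by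
    have : q ^ 3 = l ^ 2 * (x ^ 2 * q) := by linear_combination (q - l * x) * hq2'
    rw [this, hl]
    simp only [Algebra.smul_def, map_add, map_mul, map_pow, map_ofNat, map_sub]
    linear_combination algebraMap K R δ ^ 2 * hx2q +
      (2 * algebraMap K R δ * algebraMap K R e + algebraMap K R e ^ 2 * x) * hx3q +
      algebraMap K R e ^ 2 * (algebraMap K R τ - algebraMap K R δ) * pow_x
  have hp4 : p ^ 4 = (δ ^ 3 * τ) • x ^ 4 := by
    have : p ^ 4 = l ^ 3 * (x ^ 3 * p) := by
      linear_combination (p ^ 2 + l * x * p + (l * x) ^ 2) * hp2'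
    rw [this, hl3, hx3p]
    simp only [Algebra.smul_def, map_mul, map_pow]
    linear_combination ε * algebraMap K R τ * pow_x
  have hq4 : q ^ 4 = (δ ^ 3 * (δ - τ)) • x ^ 4 := by
    have : q ^ 4 = - l ^ 3 * (x ^ 3 * q) := by
      linear_combination (q ^ 2 - l * x * q + (l * x) ^ 2) * hq2'
    rw [this, neg_mul, hl3, hx3q]
    simp only [Algebra.smul_def, map_mul, map_pow, map_sub]
    linear_combination -ε * (algebraMap K R τ - algebraMap K R δ) * pow_x
  have hspan : ⊤ ≤ Submodule.span K
      (Set.range ![1, p, p ^ 2, p ^ 3, q, q ^ 2, q ^ 3, x ^ 4, z, w]) := by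
    refine span.trans (Submodule.span_le.2 ?_)
    obtain ⟨S, hS⟩ : ∃ S : Submodule K R, Submodule.span K
        (Set.range ![1, p, p ^ 2, p ^ 3, q, q ^ 2, q ^ 3, x ^ 4, z, w]) = S := ⟨_, rfl⟩
    rw [hS]
    have he : ∀ i, ![1, p, p ^ 2, p ^ 3, q, q ^ 2, q ^ 3, x ^ 4, z, w] i ∈ S := fun i =>
      hS ▸ Submodule.subset_span ⟨i, rfl⟩
    have m0 : (0 : R) ∈ S := zero_mem S
    have m1 : (1 : R) ∈ S := he 0
    have mp : p ∈ S := he 1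
    have mp2 : p ^ 2 ∈ S := he 2
    have mp3 : p ^ 3 ∈ S := he 3
    have mq : q ∈ S := he 4
    have mq2 : q ^ 2 ∈ S := he 5
    have mq3 : q ^ 3 ∈ S := he 6
    have ms : x ^ 4 ∈ S := he 7
    have mx2y : x ^ 2 * y ∈ S := (S.smul_mem_iff (pow_ne_zero 2 hδ)).1 <|
      mem_of_eq_comb mp3 ms m0 m0 1 (-(δ ^ 2 * u + 2 * δ * e * τ)) 0 0 (by rw [hp3]; module)
    have mx3 : x ^ 3 ∈ S := (S.smul_mem_iff (pow_ne_zero 3 hδ)).1 <|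
      mem_of_eq_comb mq3 mx2y ms m0 (-1) (δ ^ 2) (δ ^ 2 * (u - e) + 2 * δ * e * (τ - δ)) 0
        (by rw [hq3]; module)
    have mxy : x * y ∈ S := (S.smul_mem_iff hδ).1 <|
      mem_of_eq_comb mp2 mx3 mx2y ms 1 (-(δ * u)) (-e) (-(δ * u' + e * u)) (by
        simp only [Algebra.smul_def, map_neg, map_add, map_mul, map_one]
        linear_combination -hp2 - algebraMap K R δ * hxp - algebraMap K R e * hx2p)
    have mx2 : x ^ 2 ∈ S := (S.smul_mem_iff (pow_ne_zero 2 hδ)).1 <|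
      mem_of_eq_comb (mem_of_eq_comb mq2 mxy mx3 ms 1 δ (δ * u - 2 * δ * e)
        (δ * u' + e * (u - e)) rfl) mx2y m0 m0 1 e 0 0 (by
        simp only [Algebra.smul_def, map_add, map_mul, map_one, map_sub, map_pow,
          map_ofNat]
        linear_combination -hq2 + algebraMap K R δ * (hxp + x * hq) + algebraMap K R e * hx2q)
    have mx : x ∈ S := (S.smul_mem_iff hδ).1 <|
      mem_of_eq_comb mp mq mx2 m0 1 (-1) (-e) 0 (by
        simp only [Algebra.smul_def, map_neg, map_one]
        linear_combination hq)
    have my : y ∈ S := mem_of_eq_comb mp mx2 mx3 m0 1 (-u) (-u') 0 (by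
      simp only [Algebra.smul_def, map_neg, map_one]
      linear_combination -hp)
    rintro _ ⟨i, rfl⟩
    fin_cases i
    exacts [m1, mx, mx2, mx3, ms, my, mxy, mx2y, he 8, he 9]
  have hadj : Algebra.adjoin K (Set.range ![p, q, z, w]) = ⊤ := by
    refine adjoin_eq_top_of_span _ _ hspan fun i => ?_
    generalize hS : Algebra.adjoin K (Set.range ![p, q, z, w]) = S
    have hm : ∀ i, ![p, q, z, w] i ∈ S := fun i => hS ▸ Algebra.subset_adjoin ⟨i, rfl⟩
    have mp : p ∈ S := hm 0
    have mq : q ∈ S := hm 1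
    have ms : x ^ 4 ∈ S := by
      rw [← Subalgebra.mem_toSubmodule]
      by_cases hτ : τ = 0
      · refine (S.toSubmodule.smul_mem_iff (s := δ ^ 3 * (δ - τ)) ?_).1
          (hq4 ▸ (Subalgebra.mem_toSubmodule _).2 (pow_mem mq 4))
        rw [hτ, sub_zero]
        exact mul_ne_zero (pow_ne_zero 3 hδ) hδ
      · exact (S.toSubmodule.smul_mem_iff (mul_ne_zero (pow_ne_zero 3 hδ) hτ)).1
          (hp4 ▸ (Subalgebra.mem_toSubmodule _).2 (pow_mem mp 4))
    fin_cases i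
    exacts [one_mem S, mp, pow_mem mp _, pow_mem mp _, mq, pow_mem mq _, pow_mem mq _, ms, hm 2,
      hm 3]
  have hps : p * x ^ 4 = 0 := by
    linear_combination x * hx3p + algebraMap K R τ * pow_x
  have hqs : q * x ^ 4 = 0 := by
    linear_combination x * hx3q + (algebraMap K R τ - algebraMap K R δ) * pow_x
  have hvp : ∀ v : R, x * v = 0 → v * p = v * y := fun v hv => by
    rw [hp]
    linear_combination (algebraMap K R u * x + algebraMap K R u' * x ^ 2) * hv
  have hvq : ∀ v : R, x * v = 0 → v * q = v * y := fun v hv => by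
    rw [hq, mul_sub, mul_sub, hvp v hv]
    linear_combination (- algebraMap K R δ - algebraMap K R e * x) * hv
  refine EndClosure.mulLeft_of_adjoin_eq_top ?_ hadj _
  have hzs : z * x ^ 4 = 0 := by linear_combination x ^ 3 * mul_xz
  have hws : w * x ^ 4 = 0 := by linear_combination x ^ 3 * mul_xw
  have hzp := hvp z mul_xz
  have hzq := hvq z mul_xz
  have hwp := hvp w mul_xw
  have hwq := hvq w mul_xw
  rw [mul_zy] at hzp hzq
  rw [mul_wy] at hwp hwq
  by_cases hτ : τ = 0
  · have key : ∀ i, algebraMap K R (g i) * (x ^ 2 * y) + algebraMap K R (f i) * x ^ 4 =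
        (g i * d ^ 2) • p ^ 3 + (f i - g i * u) • x ^ 4 := by
      intro i
      have h1 : (g i * d ^ 2) * δ ^ 2 = g i := by linear_combination g i * (d * δ + 1) * hd
      rw [hp3, smul_add, smul_smul, smul_smul, h1, hτ, ← Algebra.smul_def, ← Algebra.smul_def,
        add_assoc, ← add_smul]
      congr 2
      linear_combination -u * h1
    exact endClosure_of_two_chains_of_pow_eq_zero hR p q z w (x ^ 4) hspan hpq hq4
      (by rw [hp4, hτ, mul_zero, zero_smul]) hps hqs hzs hws
      (α := fun k => g (![0, 0, 1, 1, 2, 3, 4] k) * d ^ 2)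
      (β := fun k => f (![0, 0, 1, 1, 2, 3, 4] k) - g (![0, 0, 1, 1, 2, 3, 4] k) * u)
      (hzp.trans (key 0)) (hzq.trans (key 0)) (hwp.trans (key 1)) (hwq.trans (key 1))
      (mul_zz.trans (key 2)) (mul_zw.trans (key 3)) (mul_ww.trans (key 4))
  · have key : ∀ i, algebraMap K R (g i) * (x ^ 2 * y) + algebraMap K R (f i) * x ^ 4 =
        f i • x ^ 4 := by
      intro i
      rw [(mul_eq_zero.1 (coeff i)).resolve_right hτ, map_zero, zero_mul, zero_add,
        Algebra.smul_def]
    exact endClosure_of_two_chains hR p q z w (x ^ 4) hspan hpq hq4 hp4 hps hqs hzs hws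
      (β := fun k => f (![0, 0, 1, 1, 2, 3, 4] k))
      (hzp.trans (key 0)) (hzq.trans (key 0)) (hwp.trans (key 1)) (hwq.trans (key 1))
      (mul_zz.trans (key 2)) (mul_zw.trans (key 3)) (mul_ww.trans (key 4))

end NormalForm

section CyclicVector

universe u

variable {K N : Type*} {V : Type u} [Field K] [AddCommGroup V] [Module K V]

theorem exists_algebra_of_cyclic (T : N → Module.End K V) (hT : ∀ i j, T i * T j = T j * T i)
    (v : V) (hv : ∀ u, ∃ r ∈ Algebra.adjoin K (Set.range T), r v = u) :
    ∃ (R : Type u) (_ : CommRing R) (_ : Algebra K R) (e : R ≃ₗ[K] V) (t : N → R),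
      e 1 = v ∧ (∀ i r, e (t i * r) = T i (e r)) ∧ Algebra.adjoin K (Set.range t) = ⊤ := by
  let A := Algebra.adjoin K (Set.range T)
  have hA : ∀ a b : A, a * b = b * a := by
    have : IsMulCommutative A := Algebra.isMulCommutative_adjoin K (by
      rintro _ ⟨i, rfl⟩ _ ⟨j, rfl⟩
      exact hT i j)
    exact fun a b => this.is_comm.comm a b
  let _ : CommRing A := { (inferInstance : Ring A) with mul_comm := hA }
  let φ : A →ₗ[K] V := (LinearMap.applyₗ v : Module.End K V →ₗ[K] V) ∘ₗ A.val.toLinearMap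
  have hφ : ∀ a : A, φ a = (a : Module.End K V) v := fun _ => rfl
  have hbij : Function.Bijective φ := by
    constructor
    · rw [injective_iff_map_eq_zero]
      intro a ha
      refine Subtype.ext (LinearMap.ext fun u => ?_)
      obtain ⟨r, hr, rfl⟩ := hv u
      have h1 := congrArg (fun b : A => (b : Module.End K V) v) (hA a ⟨r, hr⟩)
      rw [hφ] at ha
      simpa [ha] using h1
    · intro u
      obtain ⟨r, hr, rfl⟩ := hv u
      exact ⟨⟨r, hr⟩, rfl⟩
  refine ⟨A, inferInstance, inferInstance, LinearEquiv.ofBijective φ hbij,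
    fun i => ⟨T i, Algebra.subset_adjoin ⟨i, rfl⟩⟩, rfl, fun i r => rfl, ?_⟩
  rw [eq_top_iff]
  rintro ⟨a, ha⟩ -
  have h1 : a ∈ (Algebra.adjoin K (Set.range fun i => (⟨T i, Algebra.subset_adjoin ⟨i, rfl⟩⟩ : A))).map
      A.val := by
    rw [AlgHom.map_adjoin, ← Set.range_comp]
    exact ha
  obtain ⟨b, hb, hba⟩ := h1
  have : b = ⟨a, ha⟩ := Subtype.ext hba
  exact this ▸ hb

end CyclicVector

section Deformation

variable {K R : Type*} [Field K] [CommRing R] [Algebra K R]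

theorem IsNormal.endClosure [CharZero K] [IsAlgClosed K] [Module.Finite K R]
    (hR : Module.finrank K R = 10) {x y z w : R} {δ τ a b c : K} {g f : Fin 5 → K}
    (h : IsNormal x y z w δ τ a b c g f) :
    EndClosure fun i => LinearMap.mulLeft K (![x, y, z, w] i) := by
  obtain ⟨C, hC⟩ := exists_end_of_span _ h.span hR
    ![0, 0, 0, 0, 0, x * y, x ^ 2 * y, τ • x ^ 4, 0, 0]
  have hC1 : C 1 = 0 := hC 0
  have hCx : C x = 0 := hC 1
  have hCx2 : C (x ^ 2) = 0 := hC 2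
  have hCx3 : C (x ^ 3) = 0 := hC 3
  have hCx4 : C (x ^ 4) = 0 := hC 4
  have hCy : C y = x * y := hC 5
  have hCxy : C (x * y) = x ^ 2 * y := hC 6
  have hCx2y : C (x ^ 2 * y) = τ • x ^ 4 := hC 7
  have hCz : C z = 0 := hC 8
  have hCw : C w = 0 := hC 9
  have hcomm : ∀ m : R, (∀ i, C (m * ![1, x, x ^ 2, x ^ 3, x ^ 4, y, x * y, x ^ 2 * y, z, w] i) =
      m * C (![1, x, x ^ 2, x ^ 3, x ^ 4, y, x * y, x ^ 2 * y, z, w] i)) →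
      LinearMap.mulLeft K m * C = C * LinearMap.mulLeft K m := by
    intro m hm
    refine LinearMap.ext_on_range (top_le_iff.1 h.span) fun i => ?_
    exact (hm i).symm
  have hgf : ∀ i, C (g i • (x ^ 2 * y) + f i • x ^ 4) = 0 := fun i => by
    rw [map_add, map_smul, map_smul, hCx2y, hCx4, smul_smul, h.coeff, zero_smul, smul_zero,
      add_zero]
  have hkill : ∀ m : R, x * m = 0 → ∀ r, m * (x * r) = 0 := fun m hm r => by
    rw [← mul_assoc, mul_comm m, hm, zero_mul]
  have hcx : LinearMap.mulLeft K x * C = C * LinearMap.mulLeft K x := by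
    refine hcomm x fun i => ?_
    have h5 : x * x ^ 4 = 0 := by rw [← pow_succ', h.pow_x]
    have h6 : x * (x ^ 2 * y) = τ • x ^ 4 := by rw [← h.mul_x3y]; ring
    fin_cases i
    · simp [hC1, hCx]
    · simp [hCx, ← pow_two, hCx2]
    · simp [← pow_succ', hCx3, hCx2]
    · simp [← pow_succ', hCx3, hCx4]
    · simp [h5, hCx4]
    · change C (x * y) = x * C y
      rw [hCxy, hCy]
      ring
    · change C (x * (x * y)) = x * C (x * y)
      rw [hCxy, h6, ← mul_assoc, ← pow_two, hCx2y]
    · change C (x * (x ^ 2 * y)) = x * C (x ^ 2 * y)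
      rw [h6, hCx2y, map_smul, hCx4, mul_smul_comm, h5]
    · simp [h.mul_xz, hCz]
    · simp [h.mul_xw, hCw]
  have hcm : ∀ m : R, C m = 0 → x * m = 0 → C (m * y) = 0 → C (m * z) = 0 → C (m * w) = 0 →
      LinearMap.mulLeft K m * C = C * LinearMap.mulLeft K m := by
    intro m h0 hx hy hz hw
    have h1 := hkill m hx
    have h2 : ∀ n, m * x ^ (n + 1) = 0 := fun n => by rw [pow_succ', h1]
    have h3 : ∀ n, m * (x ^ (n + 1) * y) = 0 := fun n => by rw [pow_succ', mul_assoc, h1]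
    refine hcomm m fun i => ?_
    fin_cases i
    · simp [h0, hC1]
    · simp [hCx, mul_comm m x, hx]
    · simp [hCx2, h2]
    · simp [hCx3, h2]
    · simp [hCx4, h2]
    · simp [hy, hCy, h1]
    · simp [h1, hCxy, h3]
    · simp [h3, hCx2y, h2]
    · simp [hz, hCz]
    · simp [hw, hCw]
  have hcz := hcm z hCz h.mul_xz (by rw [h.mul_zy, hgf]) (by rw [h.mul_zz, hgf])
    (by rw [h.mul_zw, hgf])
  have hcw := hcm w hCw h.mul_xw (by rw [h.mul_wy, hgf]) (by rw [mul_comm, h.mul_zw, hgf])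
    (by rw [h.mul_ww, hgf])
  refine EndClosure.of_finite (C := ![0, C, 0, 0]) {-δ, 2 * τ - δ} (by simp) fun t ht => ?_
  obtain ⟨T, hT⟩ : ∃ T : Fin 4 → Module.End K R,
    T = fun i => LinearMap.mulLeft K (![x, y, z, w] i) + t • ![0, C, 0, 0] i := ⟨_, rfl⟩
  rw [← hT]
  have hT0 : ∀ r, T 0 r = x * r := by simp [hT]
  have hT1 : ∀ r, T 1 r = y * r + t • C r := by simp [hT]
  have hT2 : ∀ r, T 2 r = z * r := by simp [hT]
  have hT3 : ∀ r, T 3 r = w * r := by simp [hT]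
  have hTT : ∀ i j, T i * T j = T j * T i := by
    have hC' : ∀ m : R, LinearMap.mulLeft K m * C = C * LinearMap.mulLeft K m → ∀ r,
        C (m * r) = m * C r := fun m hm r => (LinearMap.congr_fun hm r).symm
    intro i j
    ext r
    fin_cases i <;> fin_cases j <;> simp only [Fin.zero_eta, Fin.mk_one, Fin.reduceFinMk,
      Module.End.mul_apply, hT0, hT1, hT2, hT3, map_add, map_smul, mul_add, mul_smul_comm,
      hC' x hcx, hC' z hcz, hC' w hcw]
    all_goals
      try simp only [Algebra.smul_def]
      ring
  have hv : ∀ u, ∃ r ∈ Algebra.adjoin K (Set.range T), r (1 : R) = u := by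
    obtain ⟨S, hS⟩ : ∃ S, Algebra.adjoin K (Set.range T) = S := ⟨_, rfl⟩
    rw [hS]
    have mT : ∀ i, T i ∈ S := fun i => hS ▸ Algebra.subset_adjoin ⟨i, rfl⟩
    have m2 : T 0 ^ 2 ∈ S := pow_mem (mT 0) 2
    have m3 : T 0 ^ 3 ∈ S := pow_mem (mT 0) 3
    have m01 : T 0 * T 1 ∈ S := mul_mem (mT 0) (mT 1)
    have m21 : T 0 ^ 2 * T 1 ∈ S := mul_mem m2 (mT 1)
    have m4 : T 0 ^ 4 ∈ S := pow_mem (mT 0) 4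
    have hle : Submodule.span K
        (Set.range ![1, x, x ^ 2, x ^ 3, x ^ 4, y, x * y, x ^ 2 * y, z, w]) ≤
        S.toSubmodule.map (LinearMap.applyₗ (1 : R)) := by
      refine Submodule.span_le.2 ?_
      rintro _ ⟨i, rfl⟩
      fin_cases i
      exacts [⟨1, one_mem S, rfl⟩, ⟨_, mT 0, by simp [hT0]⟩,
        ⟨_, m2, by simp [pow_succ', hT0]⟩, ⟨_, m3, by simp [pow_succ', hT0]⟩,
        ⟨_, m4, by simp [pow_succ', hT0]⟩, ⟨_, mT 1, by simp [hT1, hC1]⟩,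
        ⟨_, m01, by simp [hT0, hT1, hC1]⟩,
        ⟨_, m21, by simp [pow_two, mul_assoc, hT0, hT1, hC1]⟩,
        ⟨_, mT 2, by simp [hT2]⟩, ⟨_, mT 3, by simp [hT3]⟩]
    intro u
    obtain ⟨r, hr, hru⟩ := hle (h.span (Submodule.mem_top : u ∈ ⊤))
    exact ⟨r, hr, hru⟩
  obtain ⟨R', _, _, e, m, he1, hem, -⟩ := exists_algebra_of_cyclic T hTT 1 hv
  have := Module.Finite.equiv e.symm
  have hm : ![m 0, m 1, m 2, m 3] = m := by
    ext i
    fin_cases i <;> rfl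
  have e0 : ∀ r, e (m 0 * r) = x * e r := fun r => by rw [hem, hT0]
  have e1 : ∀ r, e (m 1 * r) = y * e r + t • C (e r) := fun r => by rw [hem, hT1]
  have e2 : ∀ r, e (m 2 * r) = z * e r := fun r => by rw [hem, hT2]
  have e3 : ∀ r, e (m 3 * r) = w * e r := fun r => by rw [hem, hT3]
  have em : ∀ i, e (m i) = T i 1 := fun i => by
    have := hem i 1
    rwa [mul_one, he1] at this
  have em0 : e (m 0) = x := by rw [em, hT0, mul_one]
  have em1 : e (m 1) = y := by rw [em, hT1, mul_one, hC1, smul_zero, add_zero]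
  have em2 : e (m 2) = z := by rw [em, hT2, mul_one]
  have em3 : e (m 3) = w := by rw [em, hT3, mul_one]
  have ep0 : ∀ n r, e (m 0 ^ n * r) = x ^ n * e r := fun n r => by
    induction n with
    | zero => simp
    | succ n ih => rw [pow_succ', pow_succ', mul_assoc, e0, ih, mul_assoc]
  have ep : ∀ n, e (m 0 ^ n) = x ^ n := fun n => by
    have := ep0 n 1
    rwa [mul_one, he1, mul_one] at this
  have hN : IsNormal (m 0) (m 1) (m 2) (m 3) (δ + t) τ a b c g f := by
    refine ⟨?_, ?_, ?_, ?_, ?_, ?_, ?_, ?_, ?_, ?_, ?_, h.coeff⟩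
    · have hr : e '' Set.range ![1, m 0, m 0 ^ 2, m 0 ^ 3, m 0 ^ 4, m 1, m 0 * m 1,
          m 0 ^ 2 * m 1, m 2, m 3] =
          Set.range ![1, x, x ^ 2, x ^ 3, x ^ 4, y, x * y, x ^ 2 * y, z, w] := by
        rw [← Set.range_comp]
        congr 1
        ext i
        fin_cases i <;> simp [he1, e0, ep, ep0, em0, em1, em2, em3]
      intro r _
      have h1 : e r ∈ (Submodule.span K (Set.range ![1, m 0, m 0 ^ 2, m 0 ^ 3, m 0 ^ 4, m 1,
          m 0 * m 1, m 0 ^ 2 * m 1, m 2, m 3])).map e.toLinearMap := by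
        rw [Submodule.map_span, LinearEquiv.coe_coe, hr]
        exact h.span Submodule.mem_top
      obtain ⟨r', hr', hrr⟩ := h1
      rwa [← e.injective hrr]
    all_goals apply e.injective
    · rw [e0, em2, h.mul_xz, map_zero]
    · rw [e0, em3, h.mul_xw, map_zero]
    · rw [ep, h.pow_x, map_zero]
    · rw [ep0, em1, map_smul, ep, h.mul_x3y]
    · simp only [map_add, map_smul, e1, e0, ep0, ep, em1, hCy, h.mul_yy]
      module
    all_goals simp only [map_add, map_smul, e2, e3, ep0, ep, em1, em2, em3, h.mul_zy, h.mul_wy,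
      h.mul_zz, h.mul_zw, h.mul_ww]
  simp only [Set.mem_insert_iff, Set.mem_singleton_iff, not_or] at ht
  have hR' : Module.finrank K R' = 10 := by rw [e.finrank_eq, hR]
  have := hN.endClosure_of_generic hR' (fun h0 => ht.1 (by linear_combination h0))
    (fun h0 => ht.2 (by linear_combination h0))
  rw [hm] at this
  exact this.of_equiv e hem

end Deformation

section GenericElement

variable {K V : Type*} [Field K] [AddCommGroup V] [Module K V]

theorem mem_sup_span_singleton_iff {L : Submodule K V} {p q : V} :
    p ∈ L ⊔ Submodule.span K {q} ↔ ∃ m ∈ L, ∃ c : K, p = m + c • q := by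
  simp only [Submodule.mem_sup, Submodule.mem_span_singleton]
  constructor
  · rintro ⟨m, hm, _, ⟨c, rfl⟩, rfl⟩
    exact ⟨m, hm, c, rfl⟩
  · rintro ⟨m, hm, c, rfl⟩
    exact ⟨m, hm, _, ⟨c, rfl⟩, rfl⟩

theorem exists_mem_notMem_of_finrank_lt [Module.Finite K V] {L P : Submodule K V}
    (h : Module.finrank K L < Module.finrank K P) : ∃ p ∈ P, p ∉ L := by
  by_contra! hc
  exact h.not_ge (Submodule.finrank_mono hc)

theorem finrank_sup_span_singleton_le [Module.Finite K V] (L : Submodule K V) (q : V) :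
    Module.finrank K ↥(L ⊔ Submodule.span K {q}) ≤ Module.finrank K L + 1 :=
  (Submodule.finrank_add_le_finrank_add_finrank _ _).trans
    (Nat.add_le_add_left ((finrank_span_le_card {q}).trans (by simp)) _)

theorem finrank_lt_finrank_sup_span_singleton [Module.Finite K V] {L : Submodule K V} {q : V}
    (hq : q ∉ L) : Module.finrank K L < Module.finrank K ↥(L ⊔ Submodule.span K {q}) :=
  Submodule.finrank_lt_finrank_of_lt (lt_of_le_not_ge le_sup_left fun h =>
    hq (h (Submodule.mem_sup_right (Submodule.mem_span_singleton_self q))))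

theorem le_sup_of_finrank_le [Module.Finite K V] {L P : Submodule K V} (hL : L ≤ P)
    (h : Module.finrank K P ≤ Module.finrank K L + 2) {p q : V} (hp : p ∈ P) (hq : q ∈ P)
    (hpL : p ∉ L) (hqL : q ∉ L ⊔ Submodule.span K {p}) :
    P ≤ L ⊔ Submodule.span K {p} ⊔ Submodule.span K {q} := by
  have h1 := finrank_lt_finrank_sup_span_singleton hpL
  have h2 := finrank_lt_finrank_sup_span_singleton hqL
  refine (Submodule.eq_of_le_of_finrank_le ?_ (by omega)).ge
  simp only [sup_le_iff, Submodule.span_le, Set.singleton_subset_iff]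
  exact ⟨⟨hL, hp⟩, hq⟩

variable {R : Type*} [CommRing R] [Algebra K R] [Module.Finite K R]

theorem exists_pow_two_le_sup (M : Submodule K R) (hMM : M * M ≤ M)
    (h2 : Module.finrank K ↥(M ^ 2) = 5) (h3 : Module.finrank K ↥(M ^ 3) = 3) :
    ∃ x ∈ M, M ^ 2 ≤ Submodule.span K {x} * M + M ^ 3 := by
  have h32 : M ^ 3 ≤ M ^ 2 := by
    rw [pow_succ, pow_two]
    exact mul_le_mul_left hMM M
  have hmem : ∀ {a b : R}, a ∈ M → b ∈ M → a * b ∈ M ^ 2 := fun ha hb => by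
    rw [pow_two]
    exact Submodule.mul_mem_mul ha hb
  have hout : ∀ L : Submodule K R, Module.finrank K L < 5 → ∃ a ∈ M, ∃ b ∈ M, a * b ∉ L := by
    intro L hL
    by_contra! hc
    have : M ^ 2 ≤ L := by
      rw [pow_two]
      exact Submodule.mul_le.2 hc
    have := Submodule.finrank_mono this
    omega
  have key : ∀ {x u v : R}, x ∈ M → u ∈ M → v ∈ M → x * u ∉ M ^ 3 →
      x * v ∉ M ^ 3 ⊔ Submodule.span K {x * u} →
      ∃ x ∈ M, M ^ 2 ≤ Submodule.span K {x} * M + M ^ 3 := by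
    intro x u v hx hu hv h1 h2'
    refine ⟨x, hx, (le_sup_of_finrank_le h32 (by omega) (hmem hx hu) (hmem hx hv) h1 h2').trans ?_⟩
    simp only [sup_le_iff, Submodule.span_le, Set.singleton_subset_iff, SetLike.mem_coe,
      Submodule.add_eq_sup]
    exact ⟨⟨le_sup_right, Submodule.mem_sup_left
      (Submodule.mem_span_singleton_mul.2 ⟨u, hu, rfl⟩)⟩,
      Submodule.mem_sup_left (Submodule.mem_span_singleton_mul.2 ⟨v, hv, rfl⟩)⟩
  obtain ⟨a, ha, b, hb, hab⟩ := hout (M ^ 3) (by omega)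
  obtain ⟨c, hc, d, hd, hcd⟩ := hout (M ^ 3 ⊔ Submodule.span K {a * b})
    ((finrank_sup_span_singleton_le _ _).trans_lt (by omega))
  have hcd3 : c * d ∉ M ^ 3 := fun h => hcd (Submodule.mem_sup_left h)
  by_cases h1 : a * d ∈ M ^ 3 ⊔ Submodule.span K {a * b}
  swap
  · exact key ha hb hd hab h1
  by_cases h2 : b * c ∈ M ^ 3 ⊔ Submodule.span K {a * b}
  swap
  · exact key hb ha hc (mul_comm a b ▸ hab) (mul_comm a b ▸ h2)
  by_cases h3 : c * b ∈ M ^ 3 ⊔ Submodule.span K {c * d}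
  swap
  · exact key hc hd hb hcd3 h3
  by_cases h4 : d * a ∈ M ^ 3 ⊔ Submodule.span K {c * d}
  swap
  · exact key hd hc ha (mul_comm c d ▸ hcd3) (mul_comm c d ▸ h4)
  have hinf : ∀ r, r ∈ M ^ 3 ⊔ Submodule.span K {a * b} → r ∈ M ^ 3 ⊔ Submodule.span K {c * d} →
      r ∈ M ^ 3 := by
    intro r hr hr'
    obtain ⟨m, hm, α, rfl⟩ := mem_sup_span_singleton_iff.1 hr
    obtain ⟨m', hm', β, hβ⟩ := mem_sup_span_singleton_iff.1 hr'
    by_cases hβ0 : β = 0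
    · rw [hβ, hβ0, zero_smul, add_zero]
      exact hm'
    · refine absurd ((Submodule.smul_mem_iff _ hβ0).1 ?_) hcd
      rw [← sub_eq_iff_eq_add'.2 hβ]
      exact sub_mem hr (Submodule.mem_sup_left hm')
  have had := hinf _ h1 (mul_comm d a ▸ h4)
  have hcb := hinf _ (mul_comm b c ▸ h2) h3
  refine key (add_mem ha hc) hb hd (fun h => hab ?_) (fun h => hcd ?_)
  · rw [add_mul] at h
    exact (Submodule.add_mem_iff_left _ hcb).1 h
  · obtain ⟨m, hm, γ, hγ⟩ := mem_sup_span_singleton_iff.1 h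
    refine mem_sup_span_singleton_iff.2 ⟨m + γ • (c * b) - a * d,
      sub_mem (add_mem hm (Submodule.smul_mem _ _ hcb)) had, γ, ?_⟩
    rw [add_mul, add_mul, smul_add] at hγ
    linear_combination hγ

omit [Module.Finite K R] in
theorem pow_two_le_of_le_add (M : Submodule K R) (h5 : M ^ 5 = 0)
    {x : R} (h : M ^ 2 ≤ Submodule.span K {x} * M + M ^ 3) (hMM : M * M ≤ M) :
    M ^ 2 ≤ Submodule.span K {x} * M := by
  generalize Submodule.span K {x} = s at h
  have h3 : M ^ 3 ≤ s * M ^ 2 + M ^ 4 := by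
    calc M ^ 3 = M * M ^ 2 := by ring
      _ ≤ M * (s * M + M ^ 3) := mul_le_mul_right h M
      _ = s * M ^ 2 + M ^ 4 := by ring
  have h4 : M ^ 4 ≤ s * M ^ 3 := by
    calc M ^ 4 = M * M ^ 3 := by ring
      _ ≤ M * (s * M ^ 2 + M ^ 4) := mul_le_mul_right h3 M
      _ = s * M ^ 3 + M ^ 5 := by ring
      _ = s * M ^ 3 := by rw [h5, add_zero]
  have h21 : M ^ 2 ≤ M := by rwa [pow_two]
  have h31 : M ^ 3 ≤ M ^ 2 := by
    rw [pow_succ, pow_two]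
    exact mul_le_mul_left hMM M
  refine h.trans (sup_le le_rfl (h3.trans (sup_le (mul_le_mul_right h21 s) (h4.trans ?_))))
  exact mul_le_mul_right (h31.trans h21) s

omit [Module.Finite K R] in
theorem pow_add_le_of_le {M s : Submodule K R} (h : M ^ 2 ≤ s * M) (n : ℕ) :
    M ^ (n + 2) ≤ s * M ^ (n + 1) := by
  calc M ^ (n + 2) = M ^ n * M ^ 2 := by ring
    _ ≤ M ^ n * (s * M) := mul_le_mul_right h _
    _ = s * M ^ (n + 1) := by ring

theorem exists_pow_two_le_and_pow_four_ne_zero [CharZero K] (M : Submodule K R) (hMM : M * M ≤ M)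
    (h2 : Module.finrank K ↥(M ^ 2) = 5) (h3 : Module.finrank K ↥(M ^ 3) = 3)
    (h4 : Module.finrank K ↥(M ^ 4) = 1) (h5 : M ^ 5 = 0) :
    ∃ x ∈ M, M ^ 2 ≤ Submodule.span K {x} * M ∧ x ^ 4 ≠ 0 := by
  obtain ⟨x, hx, hx2⟩ := exists_pow_two_le_sup M hMM h2 h3
  replace hx2 := pow_two_le_of_le_add M h5 hx2 hMM
  by_cases hx4 : x ^ 4 = 0
  swap
  · exact ⟨x, hx, hx2, hx4⟩
  have hM4 : M ^ 4 ≤ Submodule.span K {x ^ 3} * M := by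
    have hs : Submodule.span K {x ^ 3} = Submodule.span K {x} ^ 3 := by
      rw [Submodule.span_pow, Set.singleton_pow]
    calc M ^ 4 ≤ Submodule.span K {x} * M ^ 3 := pow_add_le_of_le hx2 2
      _ ≤ Submodule.span K {x} * (Submodule.span K {x} * M ^ 2) :=
        mul_le_mul_right (pow_add_le_of_le hx2 1) _
      _ ≤ Submodule.span K {x} * (Submodule.span K {x} * (Submodule.span K {x} * M)) :=
        mul_le_mul_right (mul_le_mul_right hx2 _) _
      _ = Submodule.span K {x ^ 3} * M := by rw [hs]; ring
  obtain ⟨y, hy, hy0⟩ : ∃ y ∈ M, x ^ 3 * y ≠ 0 := by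
    by_contra! hc
    have : M ^ 4 = ⊥ := by
      rw [eq_bot_iff]
      intro r hr
      obtain ⟨y, hy, rfl⟩ := Submodule.mem_span_singleton_mul.1 (hM4 hr)
      exact hc y hy
    rw [this, finrank_bot] at h4
    exact absurd h4 zero_ne_one
  have hmem4 : ∀ {a b c d : R}, a ∈ M → b ∈ M → c ∈ M → d ∈ M → a * b * c * d ∈ M ^ 4 :=
    fun ha hb hc hd => by
      rw [pow_succ, pow_succ, pow_two]
      exact Submodule.mul_mem_mul (Submodule.mul_mem_mul (Submodule.mul_mem_mul ha hb) hc) hd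
  have hM4s : ∀ r ∈ M ^ 4, ∃ c : K, c • (x ^ 3 * y) = r := by
    intro r hr
    have hxy : x ^ 3 * y ∈ M ^ 4 := by
      have := hmem4 hx hx hx hy
      rwa [← pow_two, ← pow_succ] at this
    obtain ⟨c, hc⟩ := (finrank_eq_one_iff_of_nonzero' (⟨_, hxy⟩ : ↥(M ^ 4))
      (fun h => hy0 (congrArg Subtype.val h))).1 h4 ⟨r, hr⟩
    exact ⟨c, congrArg Subtype.val hc⟩
  obtain ⟨c₂, hc₂⟩ := hM4s _ (hmem4 hx hx hy hy)
  obtain ⟨c₃, hc₃⟩ := hM4s _ (hmem4 hx hy hy hy)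
  obtain ⟨c₄, hc₄⟩ := hM4s _ (hmem4 hy hy hy hy)
  have hpow : ∀ t : K, (x + t • y) ^ 4 = (4 * t + 6 * c₂ * t ^ 2 + 4 * c₃ * t ^ 3 + c₄ * t ^ 4) •
      (x ^ 3 * y) := by
    intro t
    simp only [Algebra.smul_def, map_add, map_mul, map_pow, map_ofNat] at hc₂ hc₃ hc₄ ⊢
    linear_combination hx4 - 6 * algebraMap K R t ^ 2 * hc₂ - 4 * algebraMap K R t ^ 3 * hc₃ -
      algebraMap K R t ^ 4 * hc₄
  obtain ⟨σ, hσ⟩ : ∃ σ : ↥(M ^ 2) →ₗ[K] M, ∀ m, x * (σ m : R) = m := by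
    have hmaps : ∀ m ∈ M, LinearMap.mulLeft K x m ∈ M ^ 2 := fun m hm => by
      rw [pow_two]
      exact Submodule.mul_mem_mul hx hm
    obtain ⟨σ, hσ⟩ := LinearMap.exists_rightInverse_of_surjective
      ((LinearMap.mulLeft K x).restrict hmaps) (by
        rw [LinearMap.range_eq_top]
        rintro ⟨r, hr⟩
        obtain ⟨m, hm, rfl⟩ := Submodule.mem_span_singleton_mul.1 (hx2 hr)
        exact ⟨⟨m, hm⟩, rfl⟩)
    exact ⟨σ, fun m => congrArg Subtype.val (LinearMap.congr_fun hσ m)⟩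
  obtain ⟨E, hE⟩ : ∃ E : Module.End K ↥(M ^ 2), ∀ m, (E m : R) = y * (σ m : R) :=
    ⟨((LinearMap.mulLeft K y).restrict (p := M) (q := M ^ 2) fun m hm => by
      rw [pow_two]
      exact Submodule.mul_mem_mul hy hm) ∘ₗ σ, fun m => rfl⟩
  let P : Polynomial K := Polynomial.C 4 * Polynomial.X + Polynomial.C (6 * c₂) * Polynomial.X ^ 2 +
    Polynomial.C (4 * c₃) * Polynomial.X ^ 3 + Polynomial.C c₄ * Polynomial.X ^ 4
  have hP : P ≠ 0 := fun h => by
    have := congrArg (Polynomial.coeff · 1) h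
    simp [P, -map_mul, Polynomial.coeff_C_mul, Polynomial.coeff_X_pow] at this
  have hfin : ((fun μ => -μ⁻¹) '' {μ | E.HasEigenvalue μ} ∪ {t | P.IsRoot t}).Finite :=
    ((Module.End.finite_hasEigenvalue E).image _).union (Polynomial.finite_setOfPred_isRoot hP)
  obtain ⟨t, ht⟩ := hfin.infinite_compl.nonempty
  simp only [Set.mem_compl_iff, Set.mem_union, not_or] at ht
  obtain ⟨ht1, ht2⟩ := ht
  have hPt : P.eval t = 4 * t + 6 * c₂ * t ^ 2 + 4 * c₃ * t ^ 3 + c₄ * t ^ 4 := by simp [P]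
  have hinj : Function.Injective (1 + t • E : Module.End K ↥(M ^ 2)) := by
    rw [injective_iff_map_eq_zero]
    intro m hm
    by_contra hm0
    have hm' : m + t • E m = 0 := hm
    have ht0 : t ≠ 0 := by
      rintro rfl
      rw [zero_smul, add_zero] at hm'
      exact hm0 hm'
    refine ht1 ⟨-t⁻¹, Module.End.hasEigenvalue_of_hasEigenvector (x := m)
      (Module.End.hasEigenvector_iff.2 ⟨Module.End.mem_eigenspace_iff.2 ?_, hm0⟩), by simp⟩
    have := congrArg (t⁻¹ • ·) hm'
    simp only [smul_add, smul_smul, inv_mul_cancel₀ ht0, one_smul, smul_zero] at this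
    rw [neg_smul, eq_neg_of_add_eq_zero_right this]
  refine ⟨x + t • y, add_mem hx (M.smul_mem t hy), fun r hr => ?_, ?_⟩
  · obtain ⟨m, hm⟩ := LinearMap.surjective_of_injective hinj ⟨r, hr⟩
    refine Submodule.mem_span_singleton_mul.2 ⟨σ m, (σ m).2, ?_⟩
    have hm' : (m : R) + t • (E m : R) = r := congrArg Subtype.val hm
    rw [add_mul, hσ, smul_mul_assoc, ← hE, hm']
  · rw [hpow, ← hPt]
    exact smul_ne_zero ht2 hy0

end GenericElement

section Relations

variable {K : Type*} [Field K]

theorem finrank_map_add_finrank_inf_ker {V W : Type*} [AddCommGroup V] [Module K V]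
    [Module.Finite K V] [AddCommGroup W] [Module K W] (f : V →ₗ[K] W) (M : Submodule K V) :
    Module.finrank K (M.map f) + Module.finrank K ↥(M ⊓ LinearMap.ker f) = Module.finrank K M := by
  rw [← (f.domRestrict M).finrank_range_add_finrank_ker, LinearMap.range_domRestrict,
    LinearMap.ker_domRestrict, ← Submodule.map_comap_subtype, Submodule.finrank_map_subtype_eq]

variable {R : Type*} [CommRing R] [Algebra K R] [Module.Finite K R]

theorem exists_generators {M : Submodule K R} (hMM : M * M ≤ M)
    (h1 : Module.finrank K M = 9) (h2 : Module.finrank K ↥(M ^ 2) = 5)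
    (h3 : Module.finrank K ↥(M ^ 3) = 3) (h4 : Module.finrank K ↥(M ^ 4) = 1) (h5 : M ^ 5 = 0)
    {x : R} (hx : x ∈ M) (hx2 : M ^ 2 ≤ Submodule.span K {x} * M) (hx4 : x ^ 4 ≠ 0) :
    ∃ y ∈ M, ∃ z ∈ M, ∃ w ∈ M, x * z = 0 ∧ x * w = 0 ∧ x ^ 3 * y = 0 ∧
      M ≤ M ^ 2 ⊔ Submodule.span K {z} ⊔ Submodule.span K {w} ⊔ Submodule.span K {y} ⊔
        Submodule.span K {x} := by
  have hM2 : M ^ 2 ≤ M := by rwa [pow_two]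
  have hK₀ : 4 ≤ Module.finrank K ↥(M ⊓ LinearMap.ker (LinearMap.mulLeft K x)) := by
    have h := finrank_map_add_finrank_inf_ker (LinearMap.mulLeft K x) M
    have : M.map (LinearMap.mulLeft K x) ≤ M ^ 2 := by
      rintro _ ⟨m, hm, rfl⟩
      rw [pow_two]
      exact Submodule.mul_mem_mul hx hm
    have := Submodule.finrank_mono this
    omega
  have hK₂ : Module.finrank K ↥(M ^ 2 ⊓ LinearMap.ker (LinearMap.mulLeft K x)) ≤ 2 := by
    have h := finrank_map_add_finrank_inf_ker (LinearMap.mulLeft K x) (M ^ 2)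
    have : M ^ 3 ≤ (M ^ 2).map (LinearMap.mulLeft K x) := fun r hr => by
      obtain ⟨m, hm, rfl⟩ := Submodule.mem_span_singleton_mul.1 (pow_add_le_of_le hx2 1 hr)
      exact ⟨m, hm, rfl⟩
    have := Submodule.finrank_mono this
    omega
  have hN : 8 ≤ Module.finrank K ↥(M ⊓ LinearMap.ker (LinearMap.mulLeft K (x ^ 3))) := by
    have h := finrank_map_add_finrank_inf_ker (LinearMap.mulLeft K (x ^ 3)) M
    have : M.map (LinearMap.mulLeft K (x ^ 3)) ≤ M ^ 4 := by
      rintro _ ⟨m, hm, rfl⟩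
      rw [pow_succ]
      exact Submodule.mul_mem_mul (Submodule.pow_mem_pow M hx 3) hm
    have := Submodule.finrank_mono this
    omega
  obtain ⟨z, ⟨hz, hxz⟩, hz2⟩ : ∃ z ∈ M ⊓ LinearMap.ker (LinearMap.mulLeft K x), z ∉ M ^ 2 := by
    by_contra! hc
    have := Submodule.finrank_mono (le_inf hc inf_le_right)
    omega
  obtain ⟨w, ⟨hw, hxw⟩, hw2⟩ : ∃ w ∈ M ⊓ LinearMap.ker (LinearMap.mulLeft K x),
      w ∉ M ^ 2 ⊔ Submodule.span K {z} := by
    by_contra! hc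
    have hle : M ⊓ LinearMap.ker (LinearMap.mulLeft K x) ≤
        M ^ 2 ⊓ LinearMap.ker (LinearMap.mulLeft K x) ⊔ Submodule.span K {z} := fun r hr => by
      obtain ⟨m, hm, c, rfl⟩ := mem_sup_span_singleton_iff.1 (hc r hr)
      exact mem_sup_span_singleton_iff.2
        ⟨m, ⟨hm, (Submodule.add_mem_iff_left _ (Submodule.smul_mem _ c hxz)).1 hr.2⟩, c, rfl⟩
    have h' := Submodule.finrank_mono hle
    have := finrank_sup_span_singleton_le
      (M ^ 2 ⊓ LinearMap.ker (LinearMap.mulLeft K x)) z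
    omega
  obtain ⟨y, ⟨hy, hxy⟩, hy2⟩ := exists_mem_notMem_of_finrank_lt
    (L := M ^ 2 ⊔ Submodule.span K {z} ⊔ Submodule.span K {w})
    (P := M ⊓ LinearMap.ker (LinearMap.mulLeft K (x ^ 3))) (by
      have h' := finrank_sup_span_singleton_le (M ^ 2) z
      have := finrank_sup_span_singleton_le (M ^ 2 ⊔ Submodule.span K {z}) w
      omega)
  replace hxz : x * z = 0 := hxz
  replace hxw : x * w = 0 := hxw
  replace hxy : x ^ 3 * y = 0 := hxy
  have hxout : x ∉ M ^ 2 ⊔ Submodule.span K {z} ⊔ Submodule.span K {w} ⊔ Submodule.span K {y} := by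
    intro h
    have hle : M ^ 2 ⊔ Submodule.span K {z} ⊔ Submodule.span K {w} ⊔ Submodule.span K {y} ≤
        LinearMap.ker (LinearMap.mulLeft K (x ^ 3)) := by
      simp only [sup_le_iff, Submodule.span_le, Set.singleton_subset_iff, SetLike.mem_coe,
        LinearMap.mem_ker, LinearMap.mulLeft_apply]
      refine ⟨⟨⟨fun m hm => ?_, ?_⟩, ?_⟩, hxy⟩
      · have : x ^ 3 * m ∈ M ^ 5 := by
          rw [show (5 : ℕ) = 3 + 2 from rfl, pow_add]
          exact Submodule.mul_mem_mul (Submodule.pow_mem_pow M hx 3) hm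
        rw [h5] at this
        exact this
      · rw [pow_succ, mul_assoc, hxz, mul_zero]
      · rw [pow_succ, mul_assoc, hxw, mul_zero]
    have := hle h
    rw [LinearMap.mem_ker, LinearMap.mulLeft_apply, ← pow_succ] at this
    exact hx4 this
  refine ⟨y, hy, z, hz, w, hw, hxz, hxw, hxy, ?_⟩
  have i1 := finrank_lt_finrank_sup_span_singleton hz2
  have i2 := finrank_lt_finrank_sup_span_singleton hw2
  have i3 := finrank_lt_finrank_sup_span_singleton hy2
  have i4 := finrank_lt_finrank_sup_span_singleton hxout
  refine (Submodule.eq_of_le_of_finrank_le ?_ (by omega)).ge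
  simp only [sup_le_iff, Submodule.span_le, Set.singleton_subset_iff]
  exact ⟨⟨⟨⟨hM2, hz⟩, hw⟩, hy⟩, hx⟩

theorem exists_isNormal [CharZero K] [IsAlgClosed K] {M : Submodule K R}
    (h0 : ⊤ ≤ M ⊔ Submodule.span K {1}) (hMM : M * M ≤ M)
    (h1 : Module.finrank K M = 9) (h2 : Module.finrank K ↥(M ^ 2) = 5)
    (h3 : Module.finrank K ↥(M ^ 3) = 3) (h4 : Module.finrank K ↥(M ^ 4) = 1) (h5 : M ^ 5 = 0) :
    ∃ (x y z w : R) (δ τ a b c : K) (g f : Fin 5 → K), IsNormal x y z w δ τ a b c g f := by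
  obtain ⟨x, hx, hx2, hx4⟩ := exists_pow_two_le_and_pow_four_ne_zero M hMM h2 h3 h4 h5
  obtain ⟨y, hy, z, hz, w, hw, hxz, hxw, hxy, hspan⟩ :=
    exists_generators hMM h1 h2 h3 h4 h5 hx hx2 hx4
  have hdM : ∀ m ∈ M, ∃ n ∈ M ^ 2, ∃ α β γ ε : K,
      m = n + γ • z + ε • w + β • y + α • x := by
    intro m hm
    obtain ⟨m₁, hm₁, α, rfl⟩ := mem_sup_span_singleton_iff.1 (hspan hm)
    obtain ⟨m₂, hm₂, β, rfl⟩ := mem_sup_span_singleton_iff.1 hm₁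
    obtain ⟨m₃, hm₃, ε, rfl⟩ := mem_sup_span_singleton_iff.1 hm₂
    obtain ⟨n, hn, γ, rfl⟩ := mem_sup_span_singleton_iff.1 hm₃
    exact ⟨n, hn, α, β, γ, ε, rfl⟩
  have hdM4 : ∀ r ∈ M ^ 4, ∃ c : K, r = c • x ^ 4 := fun r hr => by
    obtain ⟨c, hc⟩ := (finrank_eq_one_iff_of_nonzero'
      (⟨_, Submodule.pow_mem_pow M hx 4⟩ : ↥(M ^ 4))
      (fun h => hx4 (congrArg Subtype.val h))).1 h4 ⟨r, hr⟩
    exact ⟨c, (congrArg Subtype.val hc).symm⟩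
  have hdM2 : ∀ r ∈ M ^ 2, ∃ α β a b c : K,
      r = α • x ^ 2 + β • (x * y) + a • x ^ 3 + b • (x ^ 2 * y) + c • x ^ 4 := by
    intro r hr
    obtain ⟨m, hm, rfl⟩ := Submodule.mem_span_singleton_mul.1 (hx2 hr)
    obtain ⟨n, hn, α, β, γ, ε, rfl⟩ := hdM m hm
    obtain ⟨m', hm', rfl⟩ := Submodule.mem_span_singleton_mul.1 (hx2 hn)
    obtain ⟨n', hn', a, b, γ', ε', rfl⟩ := hdM m' hm'
    have hn4 : x ^ 2 * n' ∈ M ^ 4 := by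
      rw [show (4 : ℕ) = 2 + 2 from rfl, pow_add]
      exact Submodule.mul_mem_mul (Submodule.pow_mem_pow M hx 2) hn'
    obtain ⟨c, hc⟩ := hdM4 _ hn4
    refine ⟨α, β, a, b, c, ?_⟩
    simp only [Algebra.smul_def] at hc ⊢
    linear_combination hc + (algebraMap K R γ + algebraMap K R γ' * x) * hxz +
      (algebraMap K R ε + algebraMap K R ε' * x) * hxw
  have hx5 : x ^ 5 = 0 := by
    have := Submodule.pow_mem_pow M hx 5
    rw [h5] at this
    exact this
  have hind : ∀ b c : K, b • (x ^ 2 * y) + c • x ^ 4 = 0 → b = 0 ∧ c = 0 := by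
    intro b c hbc
    have hb : b = 0 := by
      by_contra hb
      have hle : M ^ 3 ≤ Submodule.span K {x ^ 4} ⊔ Submodule.span K {x ^ 3} := by
        intro r hr
        obtain ⟨n, hn, rfl⟩ := Submodule.mem_span_singleton_mul.1 (pow_add_le_of_le hx2 1 hr)
        obtain ⟨α', β', a', b', c', rfl⟩ := hdM2 n hn
        have m4 : x ^ 4 ∈ Submodule.span K {x ^ 4} ⊔ Submodule.span K {x ^ 3} :=
          Submodule.mem_sup_left (Submodule.mem_span_singleton_self _)
        have m3 : x ^ 3 ∈ Submodule.span K {x ^ 4} ⊔ Submodule.span K {x ^ 3} :=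
          Submodule.mem_sup_right (Submodule.mem_span_singleton_self _)
        have mxy : x ^ 2 * y ∈ Submodule.span K {x ^ 4} ⊔ Submodule.span K {x ^ 3} := by
          refine (Submodule.smul_mem_iff _ hb).1 ?_
          rw [eq_neg_of_add_eq_zero_left hbc]
          exact neg_mem (Submodule.smul_mem _ _ m4)
        refine mem_of_eq_comb m3 mxy m4 m4 α' β' a' 0 ?_
        simp only [Algebra.smul_def, map_zero]
        linear_combination algebraMap K R b' * hxy + algebraMap K R c' * hx5
      have e1 := Submodule.finrank_mono hle
      have e2 := finrank_sup_span_singleton_le (Submodule.span K {x ^ 4}) (x ^ 3)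
      have e3 := finrank_span_singleton (K := K) hx4
      omega
    refine ⟨hb, ?_⟩
    rw [hb, zero_smul, zero_add] at hbc
    exact (smul_eq_zero.1 hbc).resolve_right hx4
  have hmul : ∀ {u v : R}, u ∈ M → v ∈ M → u * v ∈ M ^ 2 := fun hu hv => by
    rw [pow_two]
    exact Submodule.mul_mem_mul hu hv
  obtain ⟨α, β, a, b, c, hyy⟩ := hdM2 _ (hmul hy hy)
  have hkill : ∀ v, x * v = 0 → ∀ r ∈ M ^ 2, v * r = 0 := by
    intro v hv r hr
    obtain ⟨m, -, rfl⟩ := Submodule.mem_span_singleton_mul.1 (hx2 hr)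
    rw [← mul_assoc, mul_comm v, hv, zero_mul]
  have hprod : ∀ v ∈ M, x * v = 0 → ∀ m ∈ M, ∃ g f : K,
      v * m = g • (x ^ 2 * y) + f • x ^ 4 ∧ g * α = 0 := by
    intro v hv hxv m hm
    obtain ⟨α', β', a', g, f, h⟩ := hdM2 _ (hmul hv hm)
    have hα : α' = 0 := by
      refine (smul_eq_zero.1 (?_ : α' • x ^ 4 = 0)).resolve_right hx4
      have hxy' : x ^ 4 * y = 0 := by linear_combination x * hxy
      simp only [Algebra.smul_def] at h ⊢
      linear_combination x * m * hxv - x ^ 2 * h - algebraMap K R β' * hxy -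
        algebraMap K R a' * hx5 - algebraMap K R g * hxy' - algebraMap K R f * x * hx5
    have hβa : β' = 0 ∧ a' = 0 := by
      refine hind _ _ ?_
      rw [hα, zero_smul, zero_add] at h
      simp only [Algebra.smul_def] at h ⊢
      linear_combination m * hxv - x * h - algebraMap K R g * hxy - algebraMap K R f * hx5
    rw [hα, hβa.1, hβa.2, zero_smul, zero_smul, zero_smul, zero_add, zero_add, zero_add] at h
    refine ⟨g, f, h, (smul_eq_zero.1 (?_ : (g * α) • x ^ 4 = 0)).resolve_right hx4⟩
    have hvmy := hkill v hxv _ (hmul hm hy)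
    simp only [Algebra.smul_def, map_mul] at h hyy ⊢
    linear_combination hvmy - y * h - algebraMap K R g * x ^ 2 * hyy -
      algebraMap K R g * (algebraMap K R β * hxy + algebraMap K R a * hx5 +
        algebraMap K R b * x * hxy + algebraMap K R c * x * hx5) - algebraMap K R f * x * hxy
  obtain ⟨g₀, f₀, hzy, hg₀⟩ := hprod z hz hxz y hy
  obtain ⟨g₁, f₁, hwy, hg₁⟩ := hprod w hw hxw y hy
  obtain ⟨g₂, f₂, hzz, hg₂⟩ := hprod z hz hxz z hz
  obtain ⟨g₃, f₃, hzw, hg₃⟩ := hprod z hz hxz w hw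
  obtain ⟨g₄, f₄, hww, hg₄⟩ := hprod w hw hxw w hw
  obtain ⟨θ, hθ, hθ'⟩ : ∃ θ : K, θ ^ 2 = β * θ + α ∧ ∀ g, g * α = 0 → g * θ = 0 := by
    by_cases hα : α = 0
    · exact ⟨0, by simp [hα], by simp⟩
    · obtain ⟨ρ, hρ⟩ := IsAlgClosed.exists_pow_nat_eq (β ^ 2 + 4 * α) two_pos
      refine ⟨(β + ρ) / 2, by field_simp; linear_combination hρ, fun g hg => ?_⟩
      rw [(mul_eq_zero.1 hg).resolve_right hα, zero_mul]
  have hg' : ∀ {g f : K} {r : R}, r = g • (x ^ 2 * y) + f • x ^ 4 → g * α = 0 →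
      r = g • (x ^ 2 * (y - θ • x)) + f • x ^ 4 := by
    intro g f r hr hg
    have h := congrArg (algebraMap K R) (hθ' g hg)
    rw [map_mul, map_zero] at h
    rw [hr]
    simp only [Algebra.smul_def]
    linear_combination x ^ 3 * h
  refine ⟨x, y - θ • x, z, w, β - 2 * θ, -θ, a + b * θ, b, c, ![g₀, g₁, g₂, g₃, g₄],
    ![f₀, f₁, f₂, f₃, f₄], ?_, hxz, hxw, hx5, ?_, ?_, ?_, ?_, hg' hzz hg₂, hg' hzw hg₃,
    hg' hww hg₄, ?_⟩
  · intro r _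
    obtain ⟨S, hS⟩ : ∃ S : Submodule K R, Submodule.span K (Set.range ![1, x, x ^ 2, x ^ 3, x ^ 4,
      y - θ • x, x * (y - θ • x), x ^ 2 * (y - θ • x), z, w]) = S := ⟨_, rfl⟩
    rw [hS]
    have he : ∀ i, ![1, x, x ^ 2, x ^ 3, x ^ 4, y - θ • x, x * (y - θ • x), x ^ 2 * (y - θ • x),
        z, w] i ∈ S := fun i => hS ▸ Submodule.subset_span ⟨i, rfl⟩
    have my : y ∈ S := mem_of_eq_comb (he 5) (he 1) (zero_mem S) (zero_mem S) 1 θ 0 0 (by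
      simp only [Matrix.cons_val]
      module)
    have mxy : x * y ∈ S := mem_of_eq_comb (he 6) (he 2) (zero_mem S) (zero_mem S) 1 θ 0 0 (by
      simp only [Matrix.cons_val, Algebra.smul_def, map_one]
      ring)
    have mx2y : x ^ 2 * y ∈ S := mem_of_eq_comb (he 7) (he 3) (zero_mem S) (zero_mem S) 1 θ 0 0 (by
      simp only [Matrix.cons_val, Algebra.smul_def, map_one]
      ring)
    have hM2 : M ^ 2 ≤ S := fun n hn => by
      obtain ⟨α', β', a', b', c', rfl⟩ := hdM2 n hn
      exact add_mem (mem_of_eq_comb (he 2) mxy (he 3) mx2y _ _ _ _ rfl) (S.smul_mem _ (he 4))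
    obtain ⟨m, hm, k, rfl⟩ := mem_sup_span_singleton_iff.1 (h0 (Submodule.mem_top : r ∈ ⊤))
    obtain ⟨n, hn, α', β', γ', ε', rfl⟩ := hdM m hm
    exact add_mem (add_mem (add_mem (add_mem (add_mem (hM2 hn) (S.smul_mem _ (he 8)))
      (S.smul_mem _ (he 9))) (S.smul_mem _ my)) (S.smul_mem _ (he 1))) (S.smul_mem _ (he 0))
  · simp only [Algebra.smul_def, map_neg]
    linear_combination hxy
  · have h := congrArg (algebraMap K R) hθ
    simp only [map_mul, map_add, map_pow] at h
    simp only [Algebra.smul_def, map_add, map_sub, map_mul, map_ofNat] at hyy ⊢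
    linear_combination hyy - x ^ 2 * h
  · refine Eq.trans ?_ (hg' hzy hg₀)
    rw [Algebra.smul_def]
    linear_combination -algebraMap K R θ * hxz
  · refine Eq.trans ?_ (hg' hwy hg₁)
    rw [Algebra.smul_def]
    linear_combination -algebraMap K R θ * hxw
  · intro i
    rw [mul_neg, neg_eq_zero]
    fin_cases i
    exacts [hθ' _ hg₀, hθ' _ hg₁, hθ' _ hg₂, hθ' _ hg₃, hθ' _ hg₄]

end Relations

section Words

variable {K R : Type*} [Field K] [CommRing R] [Algebra K R] {N : Type*}

theorem span_list_prod_eq_pow (t : N → R) (k : ℕ) :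
    Submodule.span K {r : R | ∃ l : List N, k + 1 ≤ l.length ∧ r = (l.map t).prod} =
      Submodule.span K {r : R | ∃ l : List N, 1 ≤ l.length ∧ r = (l.map t).prod} ^ (k + 1) := by
  induction k with
  | zero => rw [zero_add, pow_one]
  | succ k ih =>
    rw [pow_succ', ← ih, Submodule.span_mul_span]
    congr 1
    ext r
    constructor
    · rintro ⟨_ | ⟨i, l⟩, hl, rfl⟩
      · simp at hl
      · refine ⟨t i, ⟨[i], le_rfl, by simp⟩, (l.map t).prod, ⟨l, ?_, rfl⟩, by simp⟩
        simpa using hl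
    · rintro ⟨_, ⟨l, hl, rfl⟩, _, ⟨l', hl', rfl⟩, rfl⟩
      refine ⟨l ++ l', ?_, by simp⟩
      rw [List.length_append]
      omega

theorem top_le_span_list_prod_sup {t : N → R} (ht : Algebra.adjoin K (Set.range t) = ⊤) :
    ⊤ ≤ Submodule.span K {r : R | ∃ l : List N, 1 ≤ l.length ∧ r = (l.map t).prod} ⊔
      Submodule.span K {1} := by
  rw [← Algebra.top_toSubmodule, ← ht, Algebra.adjoin_eq_span, Submodule.span_le]
  intro r hr
  obtain ⟨l, hl, rfl⟩ := Submonoid.exists_list_of_mem_closure hr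
  have hl' : ∃ l' : List N, l'.map t = l := by
    rw [← Set.mem_range, Set.range_list_map]
    exact hl
  obtain ⟨_ | ⟨i, l'⟩, rfl⟩ := hl'
  · exact Submodule.mem_sup_right (Submodule.mem_span_singleton_self _)
  · exact Submodule.mem_sup_left (Submodule.subset_span ⟨i :: l', by simp, rfl⟩)

theorem map_list_prod_mul {ι : Type*} [Fintype ι] [DecidableEq ι] (A : N → Matrix ι ι K)
    (e : R ≃ₗ[K] (ι → K)) (t : N → R) (h : ∀ i r, e (t i * r) = A i *ᵥ e r) (l : List N) (r : R) :
    e ((l.map t).prod * r) = (l.map A).prod *ᵥ e r := by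
  induction l with
  | nil => simp
  | cons i l ih =>
    rw [List.map_cons, List.prod_cons, mul_assoc, h, ih, Matrix.mulVec_mulVec, List.map_cons,
      List.prod_cons]

theorem wordSpan_eq_map (A : Fin 4 → Matrix (Fin 10) (Fin 10) K) (v : Fin 10 → K)
    (e : R ≃ₗ[K] (Fin 10 → K)) (t : Fin 4 → R) (he : e 1 = v)
    (h : ∀ i r, e (t i * r) = A i *ᵥ e r) (k : ℕ) :
    wordSpan A v k = (Submodule.span K
      {r : R | ∃ l : List (Fin 4), k ≤ l.length ∧ r = (l.map t).prod}).map e.toLinearMap := by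
  rw [Submodule.map_span, wordSpan]
  congr 1
  have h' : ∀ l : List (Fin 4), e (l.map t).prod = (l.map A).prod *ᵥ v := fun l => by
    rw [← he, ← map_list_prod_mul A e t h, mul_one]
  ext u
  constructor
  · rintro ⟨l, hl, rfl⟩
    exact ⟨_, ⟨l, hl, rfl⟩, h' l⟩
  · rintro ⟨_, ⟨l, hl, rfl⟩, rfl⟩
    exact ⟨l, hl, h' l⟩

theorem exists_mem_adjoin_of_mem_wordSpan (A : Fin 4 → Matrix (Fin 10) (Fin 10) K)
    (v u : Fin 10 → K) (hu : u ∈ wordSpan A v 0) :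
    ∃ r ∈ Algebra.adjoin K (Set.range fun i => Matrix.toLin' (A i)), r v = u := by
  induction hu using Submodule.span_induction with
  | mem u hu =>
    obtain ⟨l, -, rfl⟩ := hu
    refine ⟨(l.map fun i => Matrix.toLin' (A i)).prod, ?_, ?_⟩
    · refine list_prod_mem fun q hq => ?_
      obtain ⟨i, -, rfl⟩ := List.mem_map.1 hq
      exact Algebra.subset_adjoin ⟨i, rfl⟩
    · induction l with
      | nil => simp
      | cons i l ih =>
        rw [List.map_cons, List.prod_cons, Module.End.mul_apply, ih, Matrix.toLin'_apply,
          Matrix.mulVec_mulVec, List.map_cons, List.prod_cons]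
  | zero => exact ⟨0, zero_mem _, rfl⟩
  | add u u' _ _ ih ih' =>
    obtain ⟨r, hr, rfl⟩ := ih
    obtain ⟨r', hr', rfl⟩ := ih'
    exact ⟨r + r', add_mem hr hr', rfl⟩
  | smul c u _ ih =>
    obtain ⟨r, hr, rfl⟩ := ih
    exact ⟨c • r, Subalgebra.smul_mem _ hr c, rfl⟩

end Words

end CommutingTuple

/-- **Proposition 3.6 (Sm14221).** Every local algebra with Hilbert function (1,4,2,2,1)
is smoothable, in matrix form. -/
theorem stmt19 {K : Type*} [Field K] [CharZero K] [IsAlgClosed K]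
    (A : Fin 4 → Matrix (Fin 10) (Fin 10) K) (v : Fin 10 → K)
    (hcomm : ∀ i j, A i * A j = A j * A i)
    (hnil : ∀ i, IsNilpotent (A i))
    (hcyc : wordSpan A v 0 = ⊤)
    (h1 : Module.finrank K ↥(wordSpan A v 1) = 9)
    (h2 : Module.finrank K ↥(wordSpan A v 2) = 5)
    (h3 : Module.finrank K ↥(wordSpan A v 3) = 3)
    (h4 : Module.finrank K ↥(wordSpan A v 4) = 1)
    (h5 : wordSpan A v 5 = ⊥) :
    InSimDiagClosure A := by
  obtain ⟨R, _, _, e, t, he, ht, hadj⟩ := CommutingTuple.exists_algebra_of_cyclic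
    (fun i => Matrix.toLin' (A i))
    (fun i j => by
      simp only [← Matrix.toLin'_mul, Module.End.mul_eq_comp, hcomm i j]) v
    (fun u => CommutingTuple.exists_mem_adjoin_of_mem_wordSpan A v u (hcyc ▸ Submodule.mem_top))
  have : Module.Finite K R := Module.Finite.equiv e.symm
  have hR : Module.finrank K R = 10 := by rw [e.finrank_eq, Module.finrank_fin_fun]
  let M : Submodule K R :=
    Submodule.span K {r : R | ∃ l : List (Fin 4), 1 ≤ l.length ∧ r = (l.map t).prod}
  have hM : ∀ k, wordSpan A v (k + 1) = (M ^ (k + 1)).map e.toLinearMap := fun k => by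
    rw [← CommutingTuple.span_list_prod_eq_pow]
    exact CommutingTuple.wordSpan_eq_map A v e t he ht (k + 1)
  have hrank : ∀ k, Module.finrank K ↥(M ^ (k + 1)) = Module.finrank K ↥(wordSpan A v (k + 1)) :=
    fun k => by
      rw [hM]
      exact (LinearEquiv.finrank_map_eq e _).symm
  have hMM : M * M ≤ M := by
    rw [← pow_two, ← CommutingTuple.span_list_prod_eq_pow]
    refine Submodule.span_mono ?_
    rintro _ ⟨l, hl, rfl⟩
    exact ⟨l, by omega, rfl⟩
  have hM5 : M ^ 5 = 0 := by
    have h := hM 4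
    rw [h5] at h
    exact Submodule.map_eq_bot_iff.1 h.symm
  obtain ⟨x, y, z, w, δ, τ, a, b, c, g, f, hN⟩ := CommutingTuple.exists_isNormal (M := M)
    (CommutingTuple.top_le_span_list_prod_sup hadj) hMM
    (pow_one M ▸ (hrank 0).trans h1) ((hrank 1).trans h2)
    ((hrank 2).trans h3) ((hrank 3).trans h4) hM5
  have hE := ((hN.endClosure hR).mulLeft_of_adjoin_eq_top hN.adjoin_eq_top t).of_equiv e ht
  have := (CommutingTuple.endClosure_iff (Pi.basisFun K (Fin 10)) _).1 hE
  simpa only [LinearMap.toMatrix_eq_toMatrix', LinearMap.toMatrix'_toLin'] using this
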